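/- arXiv:2402.11731 — 7 statements merged into one kernel-verified Lean document; each statement's English description precedes it below -/
import Mathlib

section
/- Let 1 < p < 2. There exists a constant C_p depending only on p such that for every positive integer L and all real numbers x_0, x_1, …, x_{L−1}: ∑_{ℓ=0}^{L−1} |∑_{k=ℓ}^{L−1} x_k|^p · 2^{(2−p)ℓ} ≤ C_p · ∑_{ℓ=0}^{L−1} |x_ℓ|^p · 2^{(2−p)ℓ}. -/
/-- Convexity of `t ↦ t ^ p`, in the form of a weighted triangle inequality. -/
lemma abs_add_rpow_le_weighted {p θ : ℝ} (hp : 1 ≤ p) (hθ0 : 0 < θ) (hθ1 : θ < 1) (a b : ℝ) :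
    |a + b| ^ p ≤ (1 - θ) ^ (1 - p) * |a| ^ p + θ ^ (1 - p) * |b| ^ p := by
  have hθ : 0 < 1 - θ := sub_pos.2 hθ1
  have scale : ∀ t : ℝ, 0 < t → ∀ c : ℝ, t * (|c| / t) ^ p = t ^ (1 - p) * |c| ^ p := by
    intro t ht c
    rw [Real.div_rpow (abs_nonneg c) ht.le, Real.rpow_sub ht, Real.rpow_one]
    ring
  have hconv := (convexOn_rpow hp).2 (x := |a| / (1 - θ)) (y := |b| / θ)
    (by simp only [Set.mem_Ici]; positivity) (by simp only [Set.mem_Ici]; positivity)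
    hθ.le hθ0.le (by ring)
  simp only [smul_eq_mul] at hconv
  rw [scale _ hθ, scale _ hθ0, mul_div_cancel₀ _ hθ.ne', mul_div_cancel₀ _ hθ0.ne'] at hconv
  exact (Real.rpow_le_rpow (abs_nonneg _) (abs_add_le a b) (by linarith)).trans hconv

/-- Lemma on weighted tail sums: For `1 < p < 2` there is a constant `C_p`
depending only on `p` such that for every positive integer `L` and all reals
`x_0, …, x_{L-1}`:
`∑_{ℓ=0}^{L-1} |∑_{k=ℓ}^{L-1} x_k|^p 2^{(2-p)ℓ} ≤ C_p ∑_{ℓ=0}^{L-1} |x_ℓ|^p 2^{(2-p)ℓ}`. -/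
theorem weighted_tail_sum_estimate (p : ℝ) (hp1 : 1 < p) (hp2 : p < 2) :
    ∃ Cp : ℝ, 0 < Cp ∧ ∀ (L : ℕ), 0 < L → ∀ x : ℕ → ℝ,
      ∑ l ∈ Finset.range L,
          |∑ k ∈ Finset.Ico l L, x k| ^ p * (2 : ℝ) ^ ((2 - p) * (l : ℝ)) ≤
        Cp * ∑ l ∈ Finset.range L, |x l| ^ p * (2 : ℝ) ^ ((2 - p) * (l : ℝ)) := by
  obtain ⟨θ, hθ0, hθ1, hθ⟩ : ∃ θ : ℝ, 0 < θ ∧ θ < 1 ∧ θ ^ (1 - p) = 2 ^ ((2 - p) / 2) := by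
    refine ⟨2 ^ (-((2 - p) / (2 * (p - 1)))), by positivity, ?_, ?_⟩
    · apply Real.rpow_lt_one_of_one_lt_of_neg one_lt_two
      have : 0 < (2 - p) / (2 * (p - 1)) := div_pos (by linarith) (by linarith)
      linarith
    · rw [← Real.rpow_mul zero_le_two]
      congr 1
      have : p - 1 ≠ 0 := by linarith
      field_simp
      ring
  set δ : ℝ := 2 ^ (-((2 - p) / 2)) with hδ
  have hδ0 : 0 < δ := by positivity
  have hδ1 : δ < 1 := Real.rpow_lt_one_of_one_lt_of_neg one_lt_two (by linarith)
  have hA : 0 < (1 - θ) ^ (1 - p) := Real.rpow_pos_of_pos (by linarith) _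
  refine ⟨(1 - θ) ^ (1 - p) / (1 - δ), div_pos hA (by linarith), fun L _ x => ?_⟩
  set g : ℕ → ℝ := fun l =>
    |∑ k ∈ Finset.Ico l L, x k| ^ p * (2 : ℝ) ^ ((2 - p) * (l : ℝ)) with hg
  have hg0 : 0 ≤ g 0 := by positivity
  have hgL : g L = 0 := by simp [hg, Real.zero_rpow (by linarith : p ≠ 0)]
  have hstep : ∀ l ∈ Finset.range L, g l ≤
      (1 - θ) ^ (1 - p) * (|x l| ^ p * (2 : ℝ) ^ ((2 - p) * (l : ℝ))) + δ * g (l + 1) := by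
    intro l hl
    have hw : θ ^ (1 - p) * (2 : ℝ) ^ ((2 - p) * (l : ℝ)) =
        δ * (2 : ℝ) ^ ((2 - p) * ((l + 1 : ℕ) : ℝ)) := by
      rw [hθ, hδ, ← Real.rpow_add two_pos, ← Real.rpow_add two_pos]
      congr 1
      push_cast
      ring
    have h := mul_le_mul_of_nonneg_right
      (abs_add_rpow_le_weighted hp1.le hθ0 hθ1 (x l) (∑ k ∈ Finset.Ico (l + 1) L, x k))
      (by positivity : 0 ≤ (2 : ℝ) ^ ((2 - p) * (l : ℝ)))
    rw [← Finset.sum_eq_sum_Ico_succ_bot (Finset.mem_range.1 hl)] at h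
    simp only [hg]
    linear_combination h + |∑ k ∈ Finset.Ico (l + 1) L, x k| ^ p * hw
  have hsum := Finset.sum_le_sum hstep
  rw [Finset.sum_add_distrib, ← Finset.mul_sum, ← Finset.mul_sum] at hsum
  have hshift : ∑ l ∈ Finset.range L, g (l + 1) ≤ ∑ l ∈ Finset.range L, g l := by
    have h := Finset.sum_range_succ' g L
    rw [Finset.sum_range_succ, hgL] at h
    linarith
  have hbound := mul_le_mul_of_nonneg_left hshift hδ0.le
  rw [div_mul_eq_mul_div, le_div_iff₀ (by linarith)]
  linarith
end

section
/- Let 1 < p < 2 and C > 1. Let L : ℝ² → ℝ be a first degree polynomial, L(x,y) = a + bx + cy, and let L̃(x,y) := L(x,0) = a + bx. Let Q = I × J ⊂ ℝ² be a closed axis-parallel square (I, J closed intervals with |I| = |J|) such that 0 ∈ CJ, where CJ is the open interval with the same center as J and length C·|J|. Then ∫_Q |L̃(x,y)|^p dx dy ≤ C_p ∫_Q |L(x,y)|^p dx dy, where C_p depends only on p and C. -/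
open MeasureTheory

/-- The value at `0` of an affine function is controlled by its values at two points whose distance
is comparable to their distance from the origin. -/
lemma abs_rpow_le_of_affine_two_points {p C A c y δ : ℝ} (hp : 0 ≤ p) (hC : 0 ≤ C) (hδ : 0 < δ)
    (hy : |y| ≤ C * δ) :
    |A| ^ p ≤ (2 * (1 + 2 * C)) ^ p * (|A + c * y| ^ p + |A + c * (y + δ / 2)| ^ p) := by
  set u := A + c * y with hu
  set v := A + c * (y + δ / 2) with hv
  have hcy : |c * y| ≤ 2 * C * (|u| + |v|) := by
    have hc : |c| * δ ≤ 2 * (|u| + |v|) := by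
      have h : |c * δ| = 2 * |v - u| := by
        rw [show c * δ = 2 * (v - u) by rw [hu, hv]; ring, abs_mul, abs_two]
      rw [abs_mul, abs_of_pos hδ] at h
      linarith [abs_sub v u]
    calc |c * y| = |c| * |y| := abs_mul c y
      _ ≤ |c| * (C * δ) := by gcongr
      _ = C * (|c| * δ) := by ring
      _ ≤ C * (2 * (|u| + |v|)) := by gcongr
      _ = 2 * C * (|u| + |v|) := by ring
  have hA : |A| ≤ |u| + |c * y| := by
    have : A = u - c * y := by rw [hu]; ring
    rw [this]
    exact abs_sub _ _
  have hmax : |A| ≤ 2 * (1 + 2 * C) * max |u| |v| := by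
    have h1 := le_max_left |u| |v|
    have h2 := le_max_right |u| |v|
    have h3 := abs_nonneg v
    calc |A| ≤ (1 + 2 * C) * (|u| + |v|) := by linarith
      _ ≤ (1 + 2 * C) * (2 * max |u| |v|) := by gcongr; linarith
      _ = _ := by ring
  have hu0 : 0 ≤ |u| ^ p := by positivity
  have hv0 : 0 ≤ |v| ^ p := by positivity
  calc |A| ^ p ≤ (2 * (1 + 2 * C) * max |u| |v|) ^ p := by gcongr
    _ = (2 * (1 + 2 * C)) ^ p * (max |u| |v|) ^ p := by
        rw [Real.mul_rpow (by positivity) (by positivity)]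
    _ ≤ _ := by
        gcongr
        rcases max_choice |u| |v| with h | h <;> rw [h] <;> linarith

/-- One-dimensional estimate: the value at `0` of an affine function is controlled by its `L^p` norm
on an interval whose points are at distance at most a multiple of its length from the origin. -/
lemma integral_abs_rpow_const_le_integral_affine {p C A c y0 δ : ℝ} (hp : 0 ≤ p) (hC : 0 ≤ C)
    (hδ : 0 < δ) (hJ : ∀ y ∈ Set.Icc y0 (y0 + δ), |y| ≤ C * δ) :
    (∫ _ in Set.Icc y0 (y0 + δ), |A| ^ p) ≤
      2 * (2 * (1 + 2 * C)) ^ p * ∫ y in Set.Icc y0 (y0 + δ), |A + c * y| ^ p := by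
  have hle : y0 ≤ y0 + δ := by linarith
  rw [integral_Icc_eq_integral_Ioc, integral_Icc_eq_integral_Ioc,
    ← intervalIntegral.integral_of_le hle, ← intervalIntegral.integral_of_le hle]
  have hcont : Continuous fun y : ℝ => |A + c * y| ^ p :=
    Continuous.rpow_const (by fun_prop) fun _ => Or.inr hp
  have hcont' : Continuous fun y : ℝ => |A + c * (y + δ / 2)| ^ p :=
    hcont.comp (continuous_add_const (δ / 2))
  have hmono : (∫ _ in y0..(y0 + δ / 2), |A| ^ p) ≤ ∫ y in y0..(y0 + δ / 2),
      (2 * (1 + 2 * C)) ^ p * (|A + c * y| ^ p + |A + c * (y + δ / 2)| ^ p) := by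
    refine intervalIntegral.integral_mono_on (by linarith) (by simp)
      ((hcont.add hcont').const_mul _ |>.intervalIntegrable _ _) fun y hy => ?_
    exact abs_rpow_le_of_affine_two_points hp hC hδ (hJ y ⟨hy.1, by linarith [hy.2]⟩)
  rw [intervalIntegral.integral_const_mul, intervalIntegral.integral_add
    (hcont.intervalIntegrable _ _) (hcont'.intervalIntegrable _ _),
    intervalIntegral.integral_comp_add_right (fun y => |A + c * y| ^ p),
    show y0 + δ / 2 + δ / 2 = y0 + δ by ring,
    intervalIntegral.integral_add_adjacent_intervals
    (hcont.intervalIntegrable _ _) (hcont.intervalIntegrable _ _)] at hmono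
  simp only [intervalIntegral.integral_const, smul_eq_mul] at hmono ⊢
  linarith

/-- Let `1 < p < 2` and `C > 1`. There is `C_p` (depending only on `p` and
`C`) such that for every first degree polynomial `L(x,y) = a + bx + cy`, with
`L̃(x,y) = a + bx`, and every closed axis-parallel square `Q = I × J` (here
`I = [x₀, x₀+δ]`, `J = [y₀, y₀+δ]`, `δ > 0`) such that `0` lies in the open interval `CJ`
with the same center as `J` and length `C·δ`, one has
`∫_Q |L̃|^p ≤ C_p ∫_Q |L|^p`. -/
theorem first_degree_poly_restriction_estimate
    (p C : ℝ) (hp1 : 1 < p) (hp2 : p < 2) (hC : 1 < C) :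
    ∃ Cp : ℝ, 0 < Cp ∧
      ∀ (a b c x0 y0 δ : ℝ), 0 < δ →
        (0 : ℝ) ∈ Set.Ioo (y0 + δ / 2 - C * δ / 2) (y0 + δ / 2 + C * δ / 2) →
        (∫ z in Set.Icc x0 (x0 + δ) ×ˢ Set.Icc y0 (y0 + δ),
            |a + b * z.1| ^ p) ≤
          Cp * ∫ z in Set.Icc x0 (x0 + δ) ×ˢ Set.Icc y0 (y0 + δ),
            |a + b * z.1 + c * z.2| ^ p := by
  have hp : 0 ≤ p := by linarith
  refine ⟨2 * (2 * (1 + 2 * C)) ^ p, by positivity, fun a b c x0 y0 δ hδ h0 => ?_⟩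
  have hJ : ∀ y ∈ Set.Icc y0 (y0 + δ), |y| ≤ C * δ := fun y hy => by
    have := mul_lt_mul_of_pos_right hC hδ
    rw [abs_le]
    constructor <;> linarith [hy.1, hy.2, h0.1, h0.2]
  have hK : IsCompact (Set.Icc x0 (x0 + δ) ×ˢ Set.Icc y0 (y0 + δ)) :=
    isCompact_Icc.prod isCompact_Icc
  have hf : IntegrableOn (fun z : ℝ × ℝ => |a + b * z.1| ^ p)
      (Set.Icc x0 (x0 + δ) ×ˢ Set.Icc y0 (y0 + δ)) (volume.prod volume) :=
    (Continuous.rpow_const (by fun_prop) fun _ => Or.inr hp).continuousOn.integrableOn_compact hK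
  have hg : IntegrableOn (fun z : ℝ × ℝ => |a + b * z.1 + c * z.2| ^ p)
      (Set.Icc x0 (x0 + δ) ×ˢ Set.Icc y0 (y0 + δ)) (volume.prod volume) :=
    (Continuous.rpow_const (by fun_prop) fun _ => Or.inr hp).continuousOn.integrableOn_compact hK
  rw [Measure.volume_eq_prod, setIntegral_prod _ hf, setIntegral_prod _ hg, ← integral_const_mul]
  rw [IntegrableOn, ← Measure.prod_restrict] at hf hg
  exact integral_mono hf.integral_prod_left (hg.integral_prod_left.const_mul _) fun x =>
    integral_abs_rpow_const_le_integral_affine (A := a + b * x) (c := c) hp (by linarith) hδ hJ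
end

section
/- Let 1 < p < 2, p̃ = (1+p)/2, and C > 1.1. Let F : ℝ² → ℝ be twice continuously differentiable, let Q ⊂ ℝ² be a closed axis-parallel square with side length δ_Q, let z̄ ∈ CQ, and set L_Q(z) := F(z̄) + (Av_Q ∇F) · (z − z̄). Then for every multi-index α with |α| ≤ 1: δ_Q^{|α|p − 2p} ∫_{1.1Q} |∂^α (F − L_Q)(z)|^p dz ≤ C_p · δ_Q² · ( (1/|CQ|) ∫_{CQ} |∇²F(z)|^{p̃} dz )^{p/p̃}, where C_p depends only on C and p. -/
open MeasureTheory

/-- The closed axis-parallel square with lower-left corner `(qx, qy)` and side length `δ`. -/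
def closedSq (qx qy δ : ℝ) : Set (ℝ × ℝ) :=
  Set.Icc qx (qx + δ) ×ˢ Set.Icc qy (qy + δ)

/-- `openSq qx qy δ C` is the open axis-parallel square `CQ` with the same center as the
closed square `Q` with corner `(qx, qy)` and side `δ`, and side length `C·δ`. -/
def openSq (qx qy δ C : ℝ) : Set (ℝ × ℝ) :=
  Set.Ioo (qx + δ / 2 - C * δ / 2) (qx + δ / 2 + C * δ / 2) ×ˢ
    Set.Ioo (qy + δ / 2 - C * δ / 2) (qy + δ / 2 + C * δ / 2)

/-- `Av_Q ∂_x F = (1/|Q|) ∫_Q ∂_x F`. -/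
noncomputable def avDx (F : ℝ × ℝ → ℝ) (qx qy δ : ℝ) : ℝ :=
  (δ ^ 2)⁻¹ * ∫ z in closedSq qx qy δ, fderiv ℝ F z (1, 0)

/-- `Av_Q ∂_y F = (1/|Q|) ∫_Q ∂_y F`. -/
noncomputable def avDy (F : ℝ × ℝ → ℝ) (qx qy δ : ℝ) : ℝ :=
  (δ ^ 2)⁻¹ * ∫ z in closedSq qx qy δ, fderiv ℝ F z (0, 1)

/-- `L_Q(z) = F(z̄) + (Av_Q ∇F)·(z - z̄)` where `z̄ = (zx, zy)`. -/
noncomputable def LQ (F : ℝ × ℝ → ℝ) (qx qy δ zx zy : ℝ) (z : ℝ × ℝ) : ℝ :=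
  F (zx, zy) + avDx F qx qy δ * (z.1 - zx) + avDy F qx qy δ * (z.2 - zy)

theorem abs_sub_le_setIntegral_of_abs_deriv_le {h h' k : ℝ → ℝ} {a b x y : ℝ}
    (hh : ∀ t, HasDerivAt h (h' t) t) (hh' : Continuous h') (hk : Continuous k)
    (hle : ∀ t ∈ Set.Icc a b, |h' t| ≤ k t) (hx : x ∈ Set.Icc a b) (hy : y ∈ Set.Icc a b) :
    |h x - h y| ≤ ∫ t in Set.Icc a b, k t := by
  have hsub : Set.uIoc y x ⊆ Set.Icc a b :=
    Set.uIoc_subset_uIcc.trans (Set.uIcc_subset_Icc hy hx)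
  rw [← intervalIntegral.integral_eq_sub_of_hasDerivAt (fun t _ => hh t)
    (hh'.intervalIntegrable _ _), ← Real.norm_eq_abs]
  calc ‖∫ t in y..x, h' t‖ ≤ ∫ t in Set.uIoc y x, ‖h' t‖ :=
        intervalIntegral.norm_integral_le_integral_norm_uIoc
    _ ≤ ∫ t in Set.Icc a b, ‖h' t‖ :=
        setIntegral_mono_set hh'.norm.continuousOn.integrableOn_Icc
          (ae_of_all _ fun _ => norm_nonneg _) hsub.eventuallyLE
    _ ≤ ∫ t in Set.Icc a b, k t :=
        setIntegral_mono_on hh'.norm.continuousOn.integrableOn_Icc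
          hk.continuousOn.integrableOn_Icc measurableSet_Icc hle

theorem Continuous.integrableOn_closedSq {f : ℝ × ℝ → ℝ} (hf : Continuous f) (qx qy δ : ℝ) :
    IntegrableOn f (closedSq qx qy δ) :=
  hf.continuousOn.integrableOn_compact (isCompact_Icc.prod isCompact_Icc)

theorem measurableSet_closedSq (qx qy δ : ℝ) : MeasurableSet (closedSq qx qy δ) :=
  measurableSet_Icc.prod measurableSet_Icc

theorem volume_real_closedSq (qx qy : ℝ) {δ : ℝ} (hδ : 0 ≤ δ) :
    volume.real (closedSq qx qy δ) = δ ^ 2 := by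
  rw [closedSq, Measure.volume_eq_prod, measureReal_prod_prod]
  simp [hδ, sq]

theorem volume_closedSq_ne_top (qx qy δ : ℝ) : volume (closedSq qx qy δ) ≠ ⊤ :=
  (isCompact_Icc.prod isCompact_Icc).measure_lt_top.ne

theorem openSq_ae_eq_closedSq (qx qy δ C : ℝ) :
    openSq qx qy δ C =ᵐ[volume]
      closedSq (qx + δ / 2 - C * δ / 2) (qy + δ / 2 - C * δ / 2) (C * δ) := by
  have h : ∀ q : ℝ, q + δ / 2 + C * δ / 2 = q + δ / 2 - C * δ / 2 + C * δ := fun q => by ring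
  rw [openSq, closedSq, h, h, Measure.volume_eq_prod]
  exact Measure.set_prod_ae_eq Ioo_ae_eq_Icc Ioo_ae_eq_Icc

theorem abs_sub_average_closedSq_le {u φ : ℝ × ℝ → ℝ} {qx qy δ v K : ℝ} (hδ : 0 < δ)
    (hu : Continuous u) (hφ : Continuous φ)
    (hle : ∀ z ∈ closedSq qx qy δ, |v - u z| ≤ K + φ z) :
    |v - (δ ^ 2)⁻¹ * ∫ z in closedSq qx qy δ, u z| ≤
      K + (δ ^ 2)⁻¹ * ∫ z in closedSq qx qy δ, φ z := by
  have hpos : 0 < δ ^ 2 := by positivity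
  have hconst : ∀ w : ℝ, ∫ _ in closedSq qx qy δ, w = δ ^ 2 * w := fun w => by
    rw [setIntegral_const, volume_real_closedSq _ _ hδ.le, smul_eq_mul]
  have hcI : ∀ w : ℝ, IntegrableOn (fun _ => w) (closedSq qx qy δ) := fun w =>
    continuous_const.integrableOn_closedSq _ _ _
  have h1 : v - (δ ^ 2)⁻¹ * ∫ z in closedSq qx qy δ, u z =
      (δ ^ 2)⁻¹ * ∫ z in closedSq qx qy δ, (v - u z) := by
    rw [integral_sub (hcI v) (hu.integrableOn_closedSq _ _ _), hconst]
    field_simp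
  have h2 : K + (δ ^ 2)⁻¹ * ∫ z in closedSq qx qy δ, φ z =
      (δ ^ 2)⁻¹ * ∫ z in closedSq qx qy δ, (K + φ z) := by
    rw [integral_add (hcI K) (hφ.integrableOn_closedSq _ _ _), hconst]
    field_simp
  rw [h1, h2, abs_mul, abs_of_pos (inv_pos.2 hpos)]
  refine mul_le_mul_of_nonneg_left ?_ (inv_pos.2 hpos).le
  refine abs_integral_le_integral_abs.trans ?_
  exact setIntegral_mono_on ((continuous_const.sub hu).abs.integrableOn_closedSq _ _ _)
    ((continuous_const.add hφ).integrableOn_closedSq _ _ _) (measurableSet_closedSq _ _ _) hle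

theorem continuous_setIntegral_snd {H : ℝ × ℝ → ℝ} (hH : Continuous H) (a b : ℝ) :
    Continuous fun x => ∫ t in Set.Icc a b, H (x, t) :=
  continuous_parametric_integral_of_continuous (f := fun x t => H (x, t)) hH isCompact_Icc

theorem continuous_setIntegral_fst {H : ℝ × ℝ → ℝ} (hH : Continuous H) (a b : ℝ) :
    Continuous fun y => ∫ t in Set.Icc a b, H (t, y) :=
  continuous_parametric_integral_of_continuous (f := fun y t => H (t, y))
    (hH.comp continuous_swap) isCompact_Icc

theorem setIntegral_closedSq_eq {H : ℝ × ℝ → ℝ} (hH : Continuous H) (a b s : ℝ) :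
    ∫ z in closedSq a b s, H z =
      ∫ x in Set.Icc a (a + s), ∫ y in Set.Icc b (b + s), H (x, y) := by
  have h := hH.integrableOn_closedSq a b s
  rw [closedSq, Measure.volume_eq_prod] at h ⊢
  exact setIntegral_prod H h

theorem setIntegral_closedSq_eq_swap {H : ℝ × ℝ → ℝ} (hH : Continuous H) (a b s : ℝ) :
    ∫ z in closedSq a b s, H z =
      ∫ y in Set.Icc b (b + s), ∫ x in Set.Icc a (a + s), H (x, y) := by
  rw [setIntegral_closedSq_eq hH]
  have h := hH.integrableOn_closedSq a b s
  rw [closedSq, Measure.volume_eq_prod, IntegrableOn, ← Measure.prod_restrict] at h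
  exact integral_integral_swap h

/-- On a square `S ⊇ Q`, the deviation of `g` from its average over `Q` is controlled by the
integral of the majorant `H` of `|∇g|` over vertical, respectively horizontal, segments. -/
theorem abs_sub_average_le_of_abs_partial_le {g g₁ g₂ H : ℝ × ℝ → ℝ} {a b s qx qy δ : ℝ}
    (hδ : 0 < δ) (hg : Continuous g) (hg₁ : Continuous g₁) (hg₂ : Continuous g₂)
    (hH : Continuous H) (hH0 : ∀ z, 0 ≤ H z)
    (hd₁ : ∀ x y, HasDerivAt (fun t => g (t, y)) (g₁ (x, y)) x)
    (hd₂ : ∀ x y, HasDerivAt (fun t => g (x, t)) (g₂ (x, y)) y)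
    (hle₁ : ∀ z, |g₁ z| ≤ H z) (hle₂ : ∀ z, |g₂ z| ≤ H z)
    (hQ₁ : Set.Icc qx (qx + δ) ⊆ Set.Icc a (a + s))
    (hQ₂ : Set.Icc qy (qy + δ) ⊆ Set.Icc b (b + s))
    {x y : ℝ} (hx : x ∈ Set.Icc a (a + s)) (hy : y ∈ Set.Icc b (b + s)) :
    |g (x, y) - (δ ^ 2)⁻¹ * ∫ z in closedSq qx qy δ, g z| ≤
        (∫ t in Set.Icc b (b + s), H (x, t)) + (∫ z in closedSq a b s, H z) / δ ∧
      |g (x, y) - (δ ^ 2)⁻¹ * ∫ z in closedSq qx qy δ, g z| ≤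
        (∫ t in Set.Icc a (a + s), H (t, y)) + (∫ z in closedSq a b s, H z) / δ := by
  have hA := continuous_setIntegral_snd hH b (b + s)
  have hB := continuous_setIntegral_fst hH a (a + s)
  have hA0 : ∀ x, 0 ≤ ∫ t in Set.Icc b (b + s), H (x, t) := fun x =>
    integral_nonneg fun _ => hH0 _
  have hB0 : ∀ y, 0 ≤ ∫ t in Set.Icc a (a + s), H (t, y) := fun y =>
    integral_nonneg fun _ => hH0 _
  have hv : ∀ x, ∀ y ∈ Set.Icc b (b + s), ∀ y' ∈ Set.Icc b (b + s),
      |g (x, y) - g (x, y')| ≤ ∫ t in Set.Icc b (b + s), H (x, t) := fun x y hy y' hy' =>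
    abs_sub_le_setIntegral_of_abs_deriv_le (fun t => hd₂ x t) (by fun_prop) (by fun_prop)
      (fun t _ => hle₂ _) hy hy'
  have hh : ∀ y, ∀ x ∈ Set.Icc a (a + s), ∀ x' ∈ Set.Icc a (a + s),
      |g (x, y) - g (x', y)| ≤ ∫ t in Set.Icc a (a + s), H (t, y) := fun y x hx x' hx' =>
    abs_sub_le_setIntegral_of_abs_deriv_le (fun t => hd₁ t y) (by fun_prop) (by fun_prop)
      (fun t _ => hle₁ _) hx hx'
  constructor
  · refine (abs_sub_average_closedSq_le (K := ∫ t in Set.Icc b (b + s), H (x, t)) hδ hg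
      (hB.comp continuous_snd) (fun z hz => ?_)).trans ?_
    · have h1 := hv x y hy z.2 (hQ₂ hz.2)
      have h2 := hh z.2 x hx z.1 (hQ₁ hz.1)
      exact (abs_sub_le _ (g (x, z.2)) _).trans (add_le_add h1 h2)
    · have h3 : ∫ z in closedSq qx qy δ, (∫ t in Set.Icc a (a + s), H (t, z.2)) ≤
          δ * ∫ z in closedSq a b s, H z := by
        rw [setIntegral_closedSq_eq (H := fun z => ∫ t in Set.Icc a (a + s), H (t, z.2))
          (hB.comp continuous_snd), setIntegral_closedSq_eq_swap hH]
        simp only [setIntegral_const, smul_eq_mul, Real.volume_real_Icc, add_sub_cancel_left,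
          max_eq_left hδ.le]
        exact mul_le_mul_of_nonneg_left (setIntegral_mono_set hB.continuousOn.integrableOn_Icc
          (ae_of_all _ hB0) hQ₂.eventuallyLE) hδ.le
      have h4 := mul_le_mul_of_nonneg_left h3 (inv_pos.2 (pow_pos hδ 2)).le
      have h5 : (δ ^ 2)⁻¹ * (δ * ∫ z in closedSq a b s, H z) =
          (∫ z in closedSq a b s, H z) / δ := by field_simp
      rw [h5] at h4
      simpa using h4
  · refine (abs_sub_average_closedSq_le (K := ∫ t in Set.Icc a (a + s), H (t, y)) hδ hg
      (hA.comp continuous_fst) (fun z hz => ?_)).trans ?_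
    · have h1 := hh y x hx z.1 (hQ₁ hz.1)
      have h2 := hv z.1 y hy z.2 (hQ₂ hz.2)
      exact (abs_sub_le _ (g (z.1, y)) _).trans (add_le_add h1 h2)
    · have h3 : ∫ z in closedSq qx qy δ, (∫ t in Set.Icc b (b + s), H (z.1, t)) ≤
          δ * ∫ z in closedSq a b s, H z := by
        rw [setIntegral_closedSq_eq_swap (H := fun z => ∫ t in Set.Icc b (b + s), H (z.1, t))
          (hA.comp continuous_fst), setIntegral_closedSq_eq hH]
        simp only [setIntegral_const, smul_eq_mul, Real.volume_real_Icc, add_sub_cancel_left,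
          max_eq_left hδ.le]
        exact mul_le_mul_of_nonneg_left (setIntegral_mono_set hA.continuousOn.integrableOn_Icc
          (ae_of_all _ hA0) hQ₁.eventuallyLE) hδ.le
      have h4 := mul_le_mul_of_nonneg_left h3 (inv_pos.2 (pow_pos hδ 2)).le
      have h5 : (δ ^ 2)⁻¹ * (δ * ∫ z in closedSq a b s, H z) =
          (∫ z in closedSq a b s, H z) / δ := by field_simp
      rw [h5] at h4
      simpa using h4

theorem rpow_average_closedSq_le {f : ℝ × ℝ → ℝ} (hf : Continuous f) (hf0 : ∀ z, 0 ≤ f z)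
    {r : ℝ} (hr : 1 ≤ r) (a b : ℝ) {s : ℝ} (hs : 0 < s) :
    ((s ^ 2)⁻¹ * ∫ z in closedSq a b s, f z) ^ r ≤
      (s ^ 2)⁻¹ * ∫ z in closedSq a b s, f z ^ r := by
  have hr0 : 0 ≤ r := zero_le_one.trans hr
  have hv := volume_real_closedSq a b hs.le
  have hne : volume (closedSq a b s) ≠ 0 := fun h => by
    rw [measureReal_def, h, ENNReal.toReal_zero] at hv
    exact (pow_pos hs 2).ne hv
  have h := (convexOn_rpow hr).map_set_average_le
    (Real.continuous_rpow_const hr0).continuousOn isClosed_Ici hne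
    (volume_closedSq_ne_top a b s) (f := f) (ae_of_all _ hf0) (hf.integrableOn_closedSq a b s)
    ((hf.rpow_const fun _ => Or.inr hr0).integrableOn_closedSq a b s)
  simpa only [setAverage_eq, hv, smul_eq_mul] using h

theorem setIntegral_prod_mul_closedSq {α β : ℝ → ℝ} (a b s : ℝ) :
    ∫ z in closedSq a b s, α z.1 * β z.2 =
      (∫ x in Set.Icc a (a + s), α x) * ∫ y in Set.Icc b (b + s), β y := by
  rw [closedSq, Measure.volume_eq_prod]
  exact setIntegral_prod_mul α β _ _

theorem setIntegral_rpow_le_of_abs_le {u : ℝ × ℝ → ℝ} {A B : ℝ → ℝ} {a b s c d r N T p : ℝ}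
    (hp0 : 0 < p) (hp2 : p ≤ 2) (hs : 0 ≤ s) (hr : 0 < r) (hu : Continuous u)
    (hA : Continuous A) (hB : Continuous B)
    (hA0 : ∀ x, 0 ≤ A x) (hT : 0 ≤ T)
    (hAN : ∫ x in Set.Icc a (a + s), A x = N) (hBN : ∫ y in Set.Icc b (b + s), B y = N)
    (hsub : closedSq c d r ⊆ closedSq a b s)
    (huA : ∀ z ∈ closedSq a b s, |u z| ≤ A z.1 + T)
    (huB : ∀ z ∈ closedSq a b s, |u z| ≤ B z.2 + T) :
    ∫ z in closedSq c d r, |u z| ^ p ≤ r ^ 2 * ((N + s * T) / r) ^ p := by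
  have hN : 0 ≤ N := hAN ▸ integral_nonneg hA0
  have hI : ∀ {f : ℝ → ℝ} (_ : Continuous f) (e : ℝ),
      ∫ x in Set.Icc e (e + s), (f x + T) = (∫ x in Set.Icc e (e + s), f x) + s * T := by
    intro f hf e
    rw [integral_add hf.continuousOn.integrableOn_Icc continuous_const.continuousOn.integrableOn_Icc,
      setIntegral_const]
    simp [hs]
  have h2 : ∫ z in closedSq c d r, |u z| ^ (2 : ℝ) ≤ (N + s * T) ^ 2 := by
    calc ∫ z in closedSq c d r, |u z| ^ (2 : ℝ)
        ≤ ∫ z in closedSq a b s, |u z| ^ (2 : ℝ) :=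
          setIntegral_mono_set
            ((hu.abs.rpow_const fun _ => Or.inr zero_le_two).integrableOn_closedSq _ _ _)
            (ae_of_all _ fun z => by positivity) hsub.eventuallyLE
      _ ≤ ∫ z in closedSq a b s, (A z.1 + T) * (B z.2 + T) := by
          refine setIntegral_mono_on
            ((hu.abs.rpow_const fun _ => Or.inr zero_le_two).integrableOn_closedSq _ _ _)
            (Continuous.integrableOn_closedSq (by fun_prop) _ _ _)
            (measurableSet_closedSq _ _ _) fun z hz => ?_
          rw [Real.rpow_two, sq]
          exact mul_le_mul (huA z hz) (huB z hz) (abs_nonneg _) (add_nonneg (hA0 _) hT)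
      _ = (N + s * T) ^ 2 := by
          rw [setIntegral_prod_mul_closedSq (α := fun x => A x + T) (β := fun y => B y + T),
            hI hA, hI hB, hAN, hBN, sq]
  have hJ := rpow_average_closedSq_le (f := fun z => |u z| ^ p)
    (hu.abs.rpow_const fun _ => Or.inr hp0.le) (fun z => by positivity)
    (r := 2 / p) ((one_le_div hp0).2 hp2) c d hr
  have hcancel : ∀ z, (|u z| ^ p) ^ (2 / p) = |u z| ^ (2 : ℝ) := fun z => by
    rw [← Real.rpow_mul (abs_nonneg _), mul_div_cancel₀ _ hp0.ne']
  simp only [hcancel] at hJ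
  have hpos : 0 < r ^ 2 := by positivity
  set m := (r ^ 2)⁻¹ * ∫ z in closedSq c d r, |u z| ^ p with hm
  have hm0 : 0 ≤ m := mul_nonneg (by positivity) (integral_nonneg fun z => by positivity)
  have hJ' : m ^ (2 / p) ≤ ((N + s * T) / r) ^ (2 : ℝ) := by
    refine hJ.trans ?_
    rw [Real.rpow_two, div_pow, div_eq_inv_mul]
    exact mul_le_mul_of_nonneg_left h2 (by positivity)
  have hq : 0 ≤ (N + s * T) / r := by positivity
  have hm1 : m ≤ ((N + s * T) / r) ^ p := by
    have h := Real.rpow_le_rpow (by positivity) hJ' (z := p / 2) (by positivity)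
    rw [← Real.rpow_mul hm0, ← Real.rpow_mul hq] at h
    rwa [show 2 / p * (p / 2) = 1 by field_simp, Real.rpow_one,
      show (2 : ℝ) * (p / 2) = p by ring] at h
  calc ∫ z in closedSq c d r, |u z| ^ p = r ^ 2 * m := by rw [hm]; field_simp
    _ ≤ _ := mul_le_mul_of_nonneg_left hm1 hpos.le

theorem hasFDerivAt_fderiv_apply {F : ℝ × ℝ → ℝ} (hF : ContDiff ℝ 2 F) (e z : ℝ × ℝ) :
    HasFDerivAt (fun w => fderiv ℝ F w e)
      ((ContinuousLinearMap.apply ℝ ℝ e).comp (fderiv ℝ (fderiv ℝ F) z)) z := by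
  have h : Differentiable ℝ (fderiv ℝ F) :=
    (hF.fderiv_right (m := 1) (by norm_num)).differentiable (by norm_num)
  exact (ContinuousLinearMap.apply ℝ ℝ e).hasFDerivAt.comp z (h z).hasFDerivAt

theorem continuous_fderiv_fderiv_apply {F : ℝ × ℝ → ℝ} (hF : ContDiff ℝ 2 F) (e v : ℝ × ℝ) :
    Continuous fun z => fderiv ℝ (fderiv ℝ F) z v e := by
  have h : Continuous (fderiv ℝ (fderiv ℝ F)) :=
    (hF.fderiv_right (m := 1) (by norm_num)).continuous_fderiv (by norm_num)
  fun_prop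

theorem abs_fderiv_fderiv_apply_le (F : ℝ × ℝ → ℝ) {e v : ℝ × ℝ} (he : ‖e‖ ≤ 1) (hv : ‖v‖ ≤ 1)
    (z : ℝ × ℝ) : |fderiv ℝ (fderiv ℝ F) z v e| ≤ ‖iteratedFDeriv ℝ 2 F z‖ := by
  have h := (iteratedFDeriv ℝ 2 F z).le_opNorm ![v, e]
  rw [iteratedFDeriv_two_apply] at h
  simp only [Matrix.cons_val_zero, Matrix.cons_val_one, Fin.prod_univ_two] at h
  refine h.trans (mul_le_of_le_one_right (norm_nonneg _) ?_)
  exact mul_le_one₀ hv (norm_nonneg _) he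

theorem hasDerivAt_mk_left {g : ℝ × ℝ → ℝ} {g' : ℝ × ℝ →L[ℝ] ℝ} {x y : ℝ}
    (h : HasFDerivAt g g' (x, y)) : HasDerivAt (fun t => g (t, y)) (g' (1, 0)) x :=
  h.comp_hasDerivAt x ((hasDerivAt_id x).prodMk (hasDerivAt_const x y))

theorem hasDerivAt_mk_right {g : ℝ × ℝ → ℝ} {g' : ℝ × ℝ →L[ℝ] ℝ} {x y : ℝ}
    (h : HasFDerivAt g g' (x, y)) : HasDerivAt (fun t => g (x, t)) (g' (0, 1)) y :=
  h.comp_hasDerivAt y ((hasDerivAt_const y x).prodMk (hasDerivAt_id y))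

/-- The partial derivatives of a `C²` function in a direction `e` of norm at most one deviate from
their average over `Q` by at most integrals of `|∇²F|` over axis-parallel segments of `S ⊇ Q`. -/
theorem abs_fderiv_sub_average_le {F : ℝ × ℝ → ℝ} (hF : ContDiff ℝ 2 F) {e : ℝ × ℝ}
    (he : ‖e‖ ≤ 1) {a b s qx qy δ : ℝ} (hδ : 0 < δ)
    (hQ₁ : Set.Icc qx (qx + δ) ⊆ Set.Icc a (a + s))
    (hQ₂ : Set.Icc qy (qy + δ) ⊆ Set.Icc b (b + s))
    {x y : ℝ} (hx : x ∈ Set.Icc a (a + s)) (hy : y ∈ Set.Icc b (b + s)) :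
    |fderiv ℝ F (x, y) e - (δ ^ 2)⁻¹ * ∫ z in closedSq qx qy δ, fderiv ℝ F z e| ≤
        (∫ t in Set.Icc b (b + s), ‖iteratedFDeriv ℝ 2 F (x, t)‖) +
          (∫ z in closedSq a b s, ‖iteratedFDeriv ℝ 2 F z‖) / δ ∧
      |fderiv ℝ F (x, y) e - (δ ^ 2)⁻¹ * ∫ z in closedSq qx qy δ, fderiv ℝ F z e| ≤
        (∫ t in Set.Icc a (a + s), ‖iteratedFDeriv ℝ 2 F (t, y)‖) +
          (∫ z in closedSq a b s, ‖iteratedFDeriv ℝ 2 F z‖) / δ :=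
  abs_sub_average_le_of_abs_partial_le (g := fun z => fderiv ℝ F z e)
    (H := fun z => ‖iteratedFDeriv ℝ 2 F z‖) hδ
    ((hF.continuous_fderiv (by norm_num)).clm_apply continuous_const)
    (continuous_fderiv_fderiv_apply hF e (1, 0)) (continuous_fderiv_fderiv_apply hF e (0, 1))
    (hF.continuous_iteratedFDeriv le_rfl).norm (fun _ => norm_nonneg _)
    (fun _ _ => hasDerivAt_mk_left (hasFDerivAt_fderiv_apply hF e _))
    (fun _ _ => hasDerivAt_mk_right (hasFDerivAt_fderiv_apply hF e _))
    (abs_fderiv_fderiv_apply_le F he (by simp [Prod.norm_def]))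
    (abs_fderiv_fderiv_apply_le F he (by simp [Prod.norm_def])) hQ₁ hQ₂ hx hy

theorem setIntegral_abs_fderiv_sub_average_rpow_le {F : ℝ × ℝ → ℝ} (hF : ContDiff ℝ 2 F)
    {e : ℝ × ℝ} (he : ‖e‖ ≤ 1) {a b s c d r qx qy δ p : ℝ} (hδ : 0 < δ)
    (hp0 : 0 < p) (hp2 : p ≤ 2) (hs : 0 ≤ s) (hr : 0 < r)
    (hQ₁ : Set.Icc qx (qx + δ) ⊆ Set.Icc a (a + s))
    (hQ₂ : Set.Icc qy (qy + δ) ⊆ Set.Icc b (b + s))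
    (hsub : closedSq c d r ⊆ closedSq a b s) :
    ∫ z in closedSq c d r,
        |fderiv ℝ F z e - (δ ^ 2)⁻¹ * ∫ z in closedSq qx qy δ, fderiv ℝ F z e| ^ p ≤
      r ^ 2 * (((∫ z in closedSq a b s, ‖iteratedFDeriv ℝ 2 F z‖) +
        s * ((∫ z in closedSq a b s, ‖iteratedFDeriv ℝ 2 F z‖) / δ)) / r) ^ p := by
  have hH : Continuous fun z => ‖iteratedFDeriv ℝ 2 F z‖ :=
    (hF.continuous_iteratedFDeriv le_rfl).norm
  have hF' : Continuous fun z => fderiv ℝ F z e :=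
    (hF.continuous_fderiv (by norm_num)).clm_apply continuous_const
  have hN : 0 ≤ ∫ z in closedSq a b s, ‖iteratedFDeriv ℝ 2 F z‖ :=
    integral_nonneg fun _ => norm_nonneg _
  refine setIntegral_rpow_le_of_abs_le hp0 hp2 hs hr (hF'.sub continuous_const)
    (continuous_setIntegral_snd hH b (b + s)) (continuous_setIntegral_fst hH a (a + s))
    (fun x => integral_nonneg fun _ => norm_nonneg _) (by positivity)
    (setIntegral_closedSq_eq hH a b s).symm (setIntegral_closedSq_eq_swap hH a b s).symm hsub
    (fun z hz => ?_) (fun z hz => ?_)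
  · exact (abs_fderiv_sub_average_le hF he hδ hQ₁ hQ₂ hz.1 hz.2).1
  · exact (abs_fderiv_sub_average_le hF he hδ hQ₁ hQ₂ hz.1 hz.2).2

theorem abs_sub_LQ_le {F : ℝ × ℝ → ℝ} (hF : ContDiff ℝ 2 F) {a b s qx qy δ zx zy : ℝ}
    (hδ : 0 < δ) (hs : 0 ≤ s)
    (hQ₁ : Set.Icc qx (qx + δ) ⊆ Set.Icc a (a + s))
    (hQ₂ : Set.Icc qy (qy + δ) ⊆ Set.Icc b (b + s))
    (hz' : (zx, zy) ∈ closedSq a b s) {z : ℝ × ℝ} (hz : z ∈ closedSq a b s) :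
    |F z - LQ F qx qy δ zx zy z| ≤
      2 * ((∫ z in closedSq a b s, ‖iteratedFDeriv ℝ 2 F z‖) +
        s * ((∫ z in closedSq a b s, ‖iteratedFDeriv ℝ 2 F z‖) / δ)) := by
  obtain ⟨x, y⟩ := z
  have hH : Continuous fun z => ‖iteratedFDeriv ℝ 2 F z‖ :=
    (hF.continuous_iteratedFDeriv le_rfl).norm
  have hA := continuous_setIntegral_snd hH b (b + s)
  have hB := continuous_setIntegral_fst hH a (a + s)
  have hF' : Continuous (fderiv ℝ F) := hF.continuous_fderiv (by norm_num)
  have hFd : ∀ z, HasFDerivAt F (fderiv ℝ F z) z := fun z =>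
    (hF.differentiable (by norm_num) z).hasFDerivAt
  set N := ∫ z in closedSq a b s, ‖iteratedFDeriv ℝ 2 F z‖ with hN
  have hI : ∀ {f : ℝ → ℝ} (_ : Continuous f) (e : ℝ), ∫ x in Set.Icc e (e + s), f x = N →
      ∫ x in Set.Icc e (e + s), (f x + N / δ) = N + s * (N / δ) := by
    intro f hf e h
    rw [integral_add hf.continuousOn.integrableOn_Icc continuous_const.continuousOn.integrableOn_Icc,
      setIntegral_const, h]
    simp [hs]
  have h1 : |(F (x, y) - avDx F qx qy δ * x) - (F (zx, y) - avDx F qx qy δ * zx)| ≤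
      N + s * (N / δ) := by
    rw [← hI hA a (setIntegral_closedSq_eq hH a b s).symm]
    refine abs_sub_le_setIntegral_of_abs_deriv_le (h := fun t => F (t, y) - avDx F qx qy δ * t)
      (h' := fun t => fderiv ℝ F (t, y) (1, 0) - avDx F qx qy δ) (fun t => ?_) (by fun_prop)
      (by fun_prop) (fun t ht => ?_) hz.1 hz'.1
    · simpa using (hasDerivAt_mk_left (hFd (t, y))).fun_sub ((hasDerivAt_id t).const_mul _)
    · exact (abs_fderiv_sub_average_le hF (by simp [Prod.norm_def]) hδ hQ₁ hQ₂ ht hz.2).1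
  have h2 : |(F (zx, y) - avDy F qx qy δ * y) - (F (zx, zy) - avDy F qx qy δ * zy)| ≤
      N + s * (N / δ) := by
    rw [← hI hB b (setIntegral_closedSq_eq_swap hH a b s).symm]
    refine abs_sub_le_setIntegral_of_abs_deriv_le (h := fun t => F (zx, t) - avDy F qx qy δ * t)
      (h' := fun t => fderiv ℝ F (zx, t) (0, 1) - avDy F qx qy δ) (fun t => ?_) (by fun_prop)
      (by fun_prop) (fun t ht => ?_) hz.2 hz'.2
    · simpa using (hasDerivAt_mk_right (hFd (zx, t))).fun_sub ((hasDerivAt_id t).const_mul _)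
    · exact (abs_fderiv_sub_average_le hF (by simp [Prod.norm_def]) hδ hQ₁ hQ₂ hz'.1 ht).2
  have h3 := abs_add_le ((F (x, y) - avDx F qx qy δ * x) - (F (zx, y) - avDx F qx qy δ * zx))
    ((F (zx, y) - avDy F qx qy δ * y) - (F (zx, zy) - avDy F qx qy δ * zy))
  rw [show F (x, y) - LQ F qx qy δ zx zy (x, y) =
    (F (x, y) - avDx F qx qy δ * x) - (F (zx, y) - avDx F qx qy δ * zx) +
    ((F (zx, y) - avDy F qx qy δ * y) - (F (zx, zy) - avDy F qx qy δ * zy)) by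
      simp only [LQ]; ring]
  linarith

/-- Let `1 < p < 2`, `p̃ = (1+p)/2`, `C > 1.1`. There is `C_p` depending only
on `C` and `p` such that for every C² function `F`, every closed square `Q` of side
`δ > 0`, and every `z̄ ∈ CQ`, with `L_Q(z) = F(z̄) + (Av_Q ∇F)·(z - z̄)`, we have, for each
multi-index `α` with `|α| ≤ 1`,
`δ^{|α|p-2p} ∫_{1.1Q} |∂^α(F - L_Q)|^p ≤ C_p δ² ((1/|CQ|) ∫_{CQ} |∇²F|^{p̃})^{p/p̃}`. -/
theorem sobolev_inequality_taylor_remainder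
    (p C : ℝ) (hp1 : 1 < p) (hp2 : p < 2) (hC : 1.1 < C) :
    ∃ Cp : ℝ, 0 < Cp ∧
      ∀ (F : ℝ × ℝ → ℝ) (qx qy δ zx zy : ℝ), ContDiff ℝ 2 F → 0 < δ →
        (zx, zy) ∈ openSq qx qy δ C →
        (δ ^ (-(2 : ℝ) * p) *
              (∫ z in openSq qx qy δ 1.1, |F z - LQ F qx qy δ zx zy z| ^ p) ≤
            Cp * δ ^ (2 : ℝ) *
              (((C * δ) ^ 2)⁻¹ *
                  ∫ z in openSq qx qy δ C,
                    ‖iteratedFDeriv ℝ 2 F z‖ ^ ((1 + p) / 2)) ^ (p / ((1 + p) / 2))) ∧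
        (δ ^ (p - 2 * p) *
              (∫ z in openSq qx qy δ 1.1,
                |fderiv ℝ F z (1, 0) - avDx F qx qy δ| ^ p) ≤
            Cp * δ ^ (2 : ℝ) *
              (((C * δ) ^ 2)⁻¹ *
                  ∫ z in openSq qx qy δ C,
                    ‖iteratedFDeriv ℝ 2 F z‖ ^ ((1 + p) / 2)) ^ (p / ((1 + p) / 2))) ∧
        (δ ^ (p - 2 * p) *
              (∫ z in openSq qx qy δ 1.1,
                |fderiv ℝ F z (0, 1) - avDy F qx qy δ| ^ p) ≤
            Cp * δ ^ (2 : ℝ) *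
              (((C * δ) ^ 2)⁻¹ *
                  ∫ z in openSq qx qy δ C,
                    ‖iteratedFDeriv ℝ 2 F z‖ ^ ((1 + p) / 2)) ^ (p / ((1 + p) / 2))) := by
  have hC0 : 0 < C := by linarith
  have hp0 : 0 < p := by linarith
  have hq0 : 0 < (1 + p) / 2 := by linarith
  refine ⟨1.1 ^ 2 * (2 * (1 + C) * C ^ 2) ^ p, by positivity, ?_⟩
  intro F qx qy δ zx zy hF hδ hz
  have hH : Continuous fun z => ‖iteratedFDeriv ℝ 2 F z‖ :=
    (hF.continuous_iteratedFDeriv le_rfl).norm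
  have hs : 0 < C * δ := by positivity
  have hr : (0 : ℝ) < 1.1 * δ := by positivity
  have hCδ : 1.1 * δ < C * δ := mul_lt_mul_of_pos_right hC hδ
  have hmem : (zx, zy) ∈
      closedSq (qx + δ / 2 - C * δ / 2) (qy + δ / 2 - C * δ / 2) (C * δ) := by
    obtain ⟨⟨h1, h2⟩, h3, h4⟩ := hz
    dsimp only at h1 h2 h3 h4
    refine ⟨⟨?_, ?_⟩, ?_, ?_⟩ <;> dsimp only <;> linarith
  have hQ : ∀ q : ℝ, Set.Icc q (q + δ) ⊆
      Set.Icc (q + δ / 2 - C * δ / 2) (q + δ / 2 - C * δ / 2 + C * δ) := fun q =>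
    Set.Icc_subset_Icc (by linarith) (by linarith)
  have hsub : closedSq (qx + δ / 2 - 1.1 * δ / 2) (qy + δ / 2 - 1.1 * δ / 2) (1.1 * δ) ⊆
      closedSq (qx + δ / 2 - C * δ / 2) (qy + δ / 2 - C * δ / 2) (C * δ) :=
    Set.prod_mono (Set.Icc_subset_Icc (by linarith) (by linarith))
      (Set.Icc_subset_Icc (by linarith) (by linarith))
  simp only [setIntegral_congr_set (openSq_ae_eq_closedSq _ _ _ _)]
  have h₀ := fun z hz => abs_sub_LQ_le hF hδ hs.le (hQ qx) (hQ qy) hmem (z := z) (hsub hz)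
  have h₁ := fun (e : ℝ × ℝ) he => setIntegral_abs_fderiv_sub_average_rpow_le hF (e := e) he hδ
    hp0 hp2.le hs.le hr (hQ qx) (hQ qy) hsub
  have hJ := rpow_average_closedSq_le hH (fun _ => norm_nonneg _) (r := (1 + p) / 2) (by linarith)
    (qx + δ / 2 - C * δ / 2) (qy + δ / 2 - C * δ / 2) hs
  have hN : 0 ≤ ∫ z in closedSq (qx + δ / 2 - C * δ / 2) (qy + δ / 2 - C * δ / 2) (C * δ),
      ‖iteratedFDeriv ℝ 2 F z‖ := integral_nonneg fun _ => norm_nonneg _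
  set N := ∫ z in closedSq (qx + δ / 2 - C * δ / 2) (qy + δ / 2 - C * δ / 2) (C * δ),
      ‖iteratedFDeriv ℝ 2 F z‖
  set X := ((C * δ) ^ 2)⁻¹ *
    ∫ z in closedSq (qx + δ / 2 - C * δ / 2) (qy + δ / 2 - C * δ / 2) (C * δ),
      ‖iteratedFDeriv ℝ 2 F z‖ ^ ((1 + p) / 2)
  have hNC : N + C * δ * (N / δ) = (1 + C) * N := by field_simp
  rw [hNC] at h₀ h₁
  have hX : (((C * δ) ^ 2)⁻¹ * N) ^ p ≤ X ^ (p / ((1 + p) / 2)) := by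
    have h := Real.rpow_le_rpow (by positivity) hJ (z := p / ((1 + p) / 2)) (by positivity)
    rwa [← Real.rpow_mul (by positivity), mul_div_cancel₀ _ hq0.ne'] at h
  have hR : (1.1 * δ) ^ 2 * (2 * ((1 + C) * N) / δ ^ 2) ^ p ≤
      1.1 ^ 2 * (2 * (1 + C) * C ^ 2) ^ p * δ ^ (2 : ℝ) * X ^ (p / ((1 + p) / 2)) := by
    rw [show 2 * ((1 + C) * N) / δ ^ 2 = 2 * (1 + C) * C ^ 2 * (((C * δ) ^ 2)⁻¹ * N) by
      field_simp, Real.mul_rpow (by positivity) (by positivity), Real.rpow_two]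
    calc _ = 1.1 ^ 2 * (2 * (1 + C) * C ^ 2) ^ p * δ ^ 2 * (((C * δ) ^ 2)⁻¹ * N) ^ p := by ring
      _ ≤ _ := mul_le_mul_of_nonneg_left hX (by positivity)
  have hgrad : ∀ w, w ≤ (1.1 * δ) ^ 2 * ((1 + C) * N / (1.1 * δ)) ^ p →
      δ ^ (p - 2 * p) * w ≤
        1.1 ^ 2 * (2 * (1 + C) * C ^ 2) ^ p * δ ^ (2 : ℝ) * X ^ (p / ((1 + p) / 2)) := by
    intro w hw
    refine le_trans ?_ hR
    rw [show p - 2 * p = -p by ring, Real.rpow_neg hδ.le, ← Real.inv_rpow hδ.le]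
    calc (δ⁻¹) ^ p * w ≤ (δ⁻¹) ^ p * ((1.1 * δ) ^ 2 * ((1 + C) * N / (1.1 * δ)) ^ p) :=
          mul_le_mul_of_nonneg_left hw (by positivity)
      _ = (1.1 * δ) ^ 2 * (δ⁻¹ * ((1 + C) * N / (1.1 * δ))) ^ p := by
          rw [Real.mul_rpow (by positivity) (by positivity)]; ring
      _ ≤ (1.1 * δ) ^ 2 * (2 * ((1 + C) * N) / δ ^ 2) ^ p := by
          refine mul_le_mul_of_nonneg_left (Real.rpow_le_rpow (by positivity) ?_ hp0.le)
            (by positivity)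
          rw [show δ⁻¹ * ((1 + C) * N / (1.1 * δ)) = 1.1⁻¹ * ((1 + C) * N / δ ^ 2) by field_simp,
            mul_div_assoc 2]
          have : (1.1 : ℝ)⁻¹ ≤ 2 := by norm_num
          gcongr
  refine ⟨?_, hgrad _ (h₁ _ (by simp [Prod.norm_def])), hgrad _ (h₁ _ (by simp [Prod.norm_def]))⟩
  refine le_trans ?_ hR
  have hL : Continuous fun z => |F z - LQ F qx qy δ zx zy z| ^ p := by
    refine Continuous.rpow_const ?_ fun _ => Or.inr hp0.le
    have := hF.continuous
    unfold LQ
    fun_prop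
  have hint : ∫ z in closedSq (qx + δ / 2 - 1.1 * δ / 2) (qy + δ / 2 - 1.1 * δ / 2) (1.1 * δ),
      |F z - LQ F qx qy δ zx zy z| ^ p ≤ (1.1 * δ) ^ 2 * (2 * ((1 + C) * N)) ^ p := by
    rw [← volume_real_closedSq (qx + δ / 2 - 1.1 * δ / 2) (qy + δ / 2 - 1.1 * δ / 2) hr.le,
      ← smul_eq_mul (volume.real _), ← setIntegral_const]
    exact setIntegral_mono_on (hL.integrableOn_closedSq _ _ _)
      (continuous_const.integrableOn_closedSq _ _ _) (measurableSet_closedSq _ _ _)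
      fun z hz => Real.rpow_le_rpow (abs_nonneg _) (h₀ z hz) hp0.le
  rw [neg_mul, Real.rpow_neg hδ.le, Real.rpow_mul hδ.le, Real.rpow_two,
    Real.div_rpow (by positivity) (by positivity)]
  calc _ ≤ ((δ ^ 2) ^ p)⁻¹ * ((1.1 * δ) ^ 2 * (2 * ((1 + C) * N)) ^ p) :=
        mul_le_mul_of_nonneg_left hint (by positivity)
    _ = _ := by ring
end

section
/- Let 1 < p < 2, p̃ = (1+p)/2, C > 1.1, and c > 0. Let F : ℝ² → ℝ be twice continuously differentiable and let Q ⊂ ℝ² be a closed axis-parallel square with side length δ_Q. Let z₁ = (x₁, 0) and z₂ = (x₂, 0) be points of CQ with |x₁ − x₂| ≥ c·δ_Q. Then δ_Q^{2−p} · | Av_Q ∂_x F − (F(z₂) − F(z₁))/(x₂ − x₁) |^p ≤ C_p · δ_Q² · ( (1/|CQ|) ∫_{CQ} |∇²F(z)|^{p̃} dz )^{p/p̃}, where C_p depends only on c, C, and p. -/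
open MeasureTheory

/-- A function of one variable oscillates on `[a, b]` by at most the integral of any continuous
majorant of its derivative. -/
lemma abs_sub_le_integral_of_abs_deriv_le {f f' g : ℝ → ℝ} (hf' : Continuous f')
    (hg : Continuous g) (hf : ∀ t, HasDerivAt f (f' t) t) (hfg : ∀ t, |f' t| ≤ g t)
    {a b s t : ℝ} (hs : s ∈ Set.Icc a b) (ht : t ∈ Set.Icc a b) :
    |f s - f t| ≤ ∫ r in a..b, g r := by
  wlog hts : t ≤ s generalizing s t
  · rw [abs_sub_comm]
    exact this ht hs (le_of_not_ge hts)
  rw [← intervalIntegral.integral_eq_sub_of_hasDerivAt (fun r _ => hf r)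
    (hf'.intervalIntegrable t s)]
  rw [← Real.norm_eq_abs]
  calc ‖∫ r in t..s, f' r‖ ≤ ∫ r in t..s, g r :=
        intervalIntegral.norm_integral_le_of_norm_le hts (.of_forall fun r _ => hfg r)
          (hg.intervalIntegrable t s)
    _ ≤ ∫ r in a..b, g r :=
        intervalIntegral.integral_mono_interval ht.1 hts hs.2
          (.of_forall fun r => (abs_nonneg _).trans (hfg r)) (hg.intervalIntegrable a b)

/-- The average of a function over a square is compared with its average over a horizontal
segment, given a majorant `g` controlling its oscillation along both coordinate directions. -/
lemma abs_average_square_sub_average_segment_le {u g : ℝ × ℝ → ℝ} (hu : Continuous u)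
    (hg : Continuous g) (hg0 : ∀ z, 0 ≤ g z) {a b c d qx qy δ x₁ x₂ y₀ : ℝ} (hδ : 0 < δ)
    (hX : ∀ s ∈ Set.Icc a b, ∀ t ∈ Set.Icc a b, ∀ y,
      |u (s, y) - u (t, y)| ≤ ∫ r in a..b, g (r, y))
    (hY : ∀ s ∈ Set.Icc c d, ∀ t ∈ Set.Icc c d, ∀ x,
      |u (x, s) - u (x, t)| ≤ ∫ r in c..d, g (x, r))
    (hqx : a ≤ qx) (hqx' : qx + δ ≤ b) (hqy : c ≤ qy) (hqy' : qy + δ ≤ d)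
    (hx₁ : a ≤ x₁) (hx : x₁ < x₂) (hx₂ : x₂ ≤ b) (hy₀ : y₀ ∈ Set.Icc c d) :
    |(δ ^ 2)⁻¹ * (∫ x in qx..qx + δ, ∫ y in qy..qy + δ, u (x, y)) -
        (∫ x in x₁..x₂, u (x, y₀)) / (x₂ - x₁)| ≤
      (∫ x in a..b, ∫ y in c..d, g (x, y)) / δ +
        (∫ x in a..b, ∫ y in c..d, g (x, y)) / (x₂ - x₁) := by
  have hx0 : 0 < x₂ - x₁ := sub_pos.2 hx
  set K := ∫ x in a..b, ∫ y in c..d, g (x, y) with hK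
  set A := (δ ^ 2)⁻¹ * (∫ x in qx..qx + δ, ∫ y in qy..qy + δ, u (x, y)) with hA
  have hswap : K = ∫ y in c..d, ∫ x in a..b, g (x, y) :=
    intervalIntegral_intervalIntegral_swap
      (hg.continuousOn.integrableOn_compact (isCompact_uIcc.prod isCompact_uIcc) |>.mono_set
        (Set.prod_mono Set.uIoc_subset_uIcc Set.uIoc_subset_uIcc))
  have hgx : Continuous fun y => ∫ x in a..b, g (x, y) :=
    intervalIntegral.continuous_parametric_intervalIntegral_of_continuous'
      (f := fun y x => g (x, y)) (by fun_prop) a b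
  have hgy : Continuous fun x => ∫ y in c..d, g (x, y) :=
    intervalIntegral.continuous_parametric_intervalIntegral_of_continuous'
      (f := fun x y => g (x, y)) (by fun_prop) c d
  set h : ℝ → ℝ := fun x => ∫ y in qy..qy + δ, u (x, y) with hh
  have hhc : Continuous h :=
    intervalIntegral.continuous_parametric_intervalIntegral_of_continuous'
      (f := fun x y => u (x, y)) (by fun_prop) _ _
  have huy : ∀ x, Continuous fun y => u (x, y) := fun x => by fun_prop
  have hux : ∀ y, Continuous fun x => u (x, y) := fun y => by fun_prop
  have hosc : ∀ s ∈ Set.Icc a b, ∀ t ∈ Set.Icc a b, |h s - h t| ≤ K := by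
    intro s hs t ht
    rw [hh]
    dsimp only
    rw [← intervalIntegral.integral_sub ((huy s).intervalIntegrable _ _)
      ((huy t).intervalIntegrable _ _), hswap, ← Real.norm_eq_abs]
    calc _ ≤ ∫ y in qy..qy + δ, ∫ x in a..b, g (x, y) :=
          intervalIntegral.norm_integral_le_of_norm_le (by linarith)
            (.of_forall fun y _ => hX s hs t ht y) (hgx.intervalIntegrable _ _)
      _ ≤ _ := intervalIntegral.integral_mono_interval hqy (by linarith) hqy'
          (.of_forall fun y => intervalIntegral.integral_nonneg (by linarith) fun _ _ => hg0 _)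
          (hgx.intervalIntegrable _ _)
  have hAh : ∀ s ∈ Set.Icc a b, |δ * A - h s| ≤ K := by
    intro s hs
    have h1 : |∫ x in qx..qx + δ, (h x - h s)| ≤ K * |qx + δ - qx| := by
      rw [← Real.norm_eq_abs]
      refine intervalIntegral.norm_integral_le_of_norm_le_const fun x hx => ?_
      rw [Set.uIoc_of_le (by linarith)] at hx
      exact hosc x ⟨by linarith [hx.1], by linarith [hx.2]⟩ s hs
    rw [intervalIntegral.integral_sub (hhc.intervalIntegrable _ _) (by simp),
      intervalIntegral.integral_const, add_sub_cancel_left, abs_of_pos hδ, smul_eq_mul] at h1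
    have h2 : (∫ x in qx..qx + δ, h x) - δ * h s = δ * (δ * A - h s) := by
      rw [hA]; field_simp
    rw [h2, abs_mul, abs_of_pos hδ, mul_comm K] at h1
    exact le_of_mul_le_mul_left h1 hδ
  clear_value A K
  have hhu : ∀ s, |h s - δ * u (s, y₀)| ≤ δ * ∫ r in c..d, g (s, r) := by
    intro s
    have h1 : |∫ y in qy..qy + δ, (u (s, y) - u (s, y₀))| ≤
        (∫ r in c..d, g (s, r)) * |qy + δ - qy| := by
      rw [← Real.norm_eq_abs]
      refine intervalIntegral.norm_integral_le_of_norm_le_const fun y hy => ?_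
      rw [Set.uIoc_of_le (by linarith)] at hy
      exact hY y ⟨by linarith [hy.1], by linarith [hy.2]⟩ y₀ hy₀ s
    rwa [intervalIntegral.integral_sub ((huy s).intervalIntegrable _ _) (by simp),
      intervalIntegral.integral_const, add_sub_cancel_left, abs_of_pos hδ, smul_eq_mul,
      mul_comm (∫ r in c..d, g (s, r))] at h1
  have hmain : |∫ s in x₁..x₂, (δ * A - δ * u (s, y₀))| ≤
      ∫ s in x₁..x₂, (K + δ * ∫ r in c..d, g (s, r)) := by
    rw [← Real.norm_eq_abs]
    refine intervalIntegral.norm_integral_le_of_norm_le hx.le (.of_forall fun s hs => ?_)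
      ((hgy.const_mul δ).const_add K |>.intervalIntegrable _ _)
    have h1 := hAh s ⟨by linarith [hs.1], by linarith [hs.2]⟩
    have h2 := hhu s
    have h3 := abs_sub_le (δ * A) (h s) (δ * u (s, y₀))
    rw [Real.norm_eq_abs]
    linarith
  have hseg : ∫ s in x₁..x₂, ∫ r in c..d, g (s, r) ≤ K := by
    rw [hK]
    exact intervalIntegral.integral_mono_interval hx₁ hx.le hx₂
      (.of_forall fun x => intervalIntegral.integral_nonneg (by linarith) fun _ _ => hg0 _)
      (hgy.intervalIntegrable _ _)
  rw [intervalIntegral.integral_sub (by simp)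
      (((hux y₀).const_mul δ).intervalIntegrable _ _),
    intervalIntegral.integral_add (by simp) ((hgy.const_mul δ).intervalIntegrable _ _),
    intervalIntegral.integral_const, intervalIntegral.integral_const,
    intervalIntegral.integral_const_mul, intervalIntegral.integral_const_mul, smul_eq_mul,
    smul_eq_mul] at hmain
  have e1 : (x₂ - x₁) * (δ * A) - δ * ∫ x in x₁..x₂, u (x, y₀) =
      (δ * (x₂ - x₁)) * (A - (∫ x in x₁..x₂, u (x, y₀)) / (x₂ - x₁)) := by
    field_simp
  have e2 : (x₂ - x₁) * K + δ * K = (δ * (x₂ - x₁)) * (K / δ + K / (x₂ - x₁)) := by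
    field_simp
  rw [e1, abs_mul, abs_of_pos (by positivity)] at hmain
  refine le_of_mul_le_mul_left (hmain.trans ?_) (show 0 < δ * (x₂ - x₁) by positivity)
  rw [← e2]
  gcongr

lemma setIntegral_Ioo_prod_Ioo_eq_intervalIntegral {f : ℝ × ℝ → ℝ} (hf : Continuous f)
    {a b c d : ℝ} (hab : a ≤ b) (hcd : c ≤ d) :
    ∫ z in Set.Ioo a b ×ˢ Set.Ioo c d, f z = ∫ x in a..b, ∫ y in c..d, f (x, y) := by
  rw [Measure.volume_eq_prod, setIntegral_prod]
  · simp_rw [intervalIntegral.integral_of_le hab, intervalIntegral.integral_of_le hcd,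
      integral_Ioc_eq_integral_Ioo]
  · exact (hf.continuousOn.integrableOn_compact (isCompact_Icc.prod isCompact_Icc)).mono_set
      (Set.prod_mono Set.Ioo_subset_Icc_self Set.Ioo_subset_Icc_self)

lemma setIntegral_closedSq_eq_intervalIntegral {f : ℝ × ℝ → ℝ} (hf : Continuous f)
    (qx qy : ℝ) {δ : ℝ} (hδ : 0 ≤ δ) :
    ∫ z in closedSq qx qy δ, f z = ∫ x in qx..qx + δ, ∫ y in qy..qy + δ, f (x, y) := by
  rw [closedSq, Measure.volume_eq_prod, setIntegral_prod]
  · simp_rw [intervalIntegral.integral_of_le (le_add_of_nonneg_right hδ),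
      integral_Icc_eq_integral_Ioc]
  · exact hf.continuousOn.integrableOn_compact (isCompact_Icc.prod isCompact_Icc)

lemma volume_real_openSq (qx qy : ℝ) {δ C : ℝ} (h : 0 ≤ C * δ) :
    volume.real (openSq qx qy δ C) = (C * δ) ^ 2 := by
  rw [openSq, Measure.volume_eq_prod, measureReal_prod_prod,
    Real.volume_real_Ioo_of_le (by linarith), Real.volume_real_Ioo_of_le (by linarith)]
  ring

/-- Jensen's inequality for powers, on an open square. -/
lemma rpow_average_openSq_le {g : ℝ × ℝ → ℝ} (hg : Continuous g) (hg0 : ∀ z, 0 ≤ g z)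
    (qx qy : ℝ) {δ C q : ℝ} (h : 0 < C * δ) (hq : 1 ≤ q) :
    (((C * δ) ^ 2)⁻¹ * ∫ z in openSq qx qy δ C, g z) ^ q ≤
      ((C * δ) ^ 2)⁻¹ * ∫ z in openSq qx qy δ C, g z ^ q := by
  have hint : ∀ f : ℝ × ℝ → ℝ, Continuous f → IntegrableOn f (openSq qx qy δ C) := fun f hf =>
    (hf.continuousOn.integrableOn_compact (isCompact_Icc.prod isCompact_Icc)).mono_set
      (Set.prod_mono Set.Ioo_subset_Icc_self Set.Ioo_subset_Icc_self)
  have hgq : Continuous fun z => g z ^ q := hg.rpow_const fun _ => .inr (by linarith)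
  have hv := volume_real_openSq qx qy h.le
  have hne : volume.real (openSq qx qy δ C) ≠ 0 := by rw [hv]; positivity
  have := (convexOn_rpow hq).map_set_average_le (μ := volume) (t := openSq qx qy δ C) (f := g)
    (Real.continuous_rpow_const (by linarith)).continuousOn isClosed_Ici
    (fun h0 => hne (by simp [Measure.real, h0]))
    (fun h0 => hne (by simp [Measure.real, h0]))
    (.of_forall hg0) (hint g hg) (hint _ hgq)
  simpa only [setAverage_eq, hv, smul_eq_mul] using this

/-- The average of `∂ₓF` over a square differs from a horizontal difference quotient by the
`L¹` norm of the Hessian over a larger square, up to scaling. -/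
lemma abs_avDx_sub_slope_le {F : ℝ × ℝ → ℝ} (hF : ContDiff ℝ 2 F) {C c qx qy δ x₁ x₂ : ℝ}
    (hC : 1 ≤ C) (hc : 0 < c) (hδ : 0 < δ) (h₁ : (x₁, (0 : ℝ)) ∈ openSq qx qy δ C)
    (h₂ : (x₂, (0 : ℝ)) ∈ openSq qx qy δ C) (h₁₂ : c * δ ≤ |x₁ - x₂|) :
    |avDx F qx qy δ - (F (x₂, 0) - F (x₁, 0)) / (x₂ - x₁)| ≤
      (1 + 1 / c) / δ * ∫ z in openSq qx qy δ C, ‖iteratedFDeriv ℝ 2 F z‖ := by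
  wlog hx : x₁ < x₂ generalizing x₁ x₂
  · have hne : x₁ ≠ x₂ := by
      rintro rfl
      rw [sub_self, abs_zero] at h₁₂
      exact absurd h₁₂ (not_le.2 (by positivity))
    have := this h₂ h₁ (abs_sub_comm x₁ x₂ ▸ h₁₂) (lt_of_le_of_ne (not_lt.1 hx) hne.symm)
    rwa [← neg_sub (F (x₂, 0)), ← neg_sub x₂, neg_div_neg_eq] at this
  set g : ℝ × ℝ → ℝ := fun z => ‖iteratedFDeriv ℝ 2 F z‖ with hgdef
  have hg : Continuous g := (hF.continuous_iteratedFDeriv le_rfl).norm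
  have hg0 : ∀ z, 0 ≤ g z := fun z => norm_nonneg _
  have hF' : ContDiff ℝ 1 (fderiv ℝ F) := hF.fderiv_right (by norm_num)
  have hu : Continuous fun z => fderiv ℝ F z (1, 0) := by
    have := hF'.continuous
    fun_prop
  have hF'' : Continuous (fderiv ℝ (fderiv ℝ F)) := hF'.continuous_fderiv one_ne_zero
  have hgnorm : ∀ z, g z = ‖fderiv ℝ (fderiv ℝ F) z‖ := fun z => by
    rw [hgdef, ← norm_iteratedFDeriv_one, norm_iteratedFDeriv_fderiv]
  have hbound : ∀ z v : ℝ × ℝ, ‖v‖ ≤ 1 → |fderiv ℝ (fderiv ℝ F) z v (1, 0)| ≤ g z := by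
    intro z v hv
    have h := (fderiv ℝ (fderiv ℝ F) z).le_opNorm₂ v (1, 0)
    rw [hgnorm]
    have hv' : ‖((1 : ℝ), (0 : ℝ))‖ = 1 := by simp [Prod.norm_def]
    rw [hv', mul_one] at h
    exact h.trans (mul_le_of_le_one_right (norm_nonneg (fderiv ℝ (fderiv ℝ F) z)) hv)
  have hdx : ∀ x y, HasDerivAt (fun t : ℝ => fderiv ℝ F (t, y) (1, 0))
      (fderiv ℝ (fderiv ℝ F) (x, y) (1, 0) (1, 0)) x := by
    intro x y
    have h := ((hF'.differentiable one_ne_zero) (x, y)).hasFDerivAt.comp_hasDerivAt x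
      ((hasDerivAt_id x).prodMk (hasDerivAt_const x y))
    exact h.clm_apply (hasDerivAt_const x ((1 : ℝ), (0 : ℝ))) |>.congr_deriv (by simp)
  have hdy : ∀ x y, HasDerivAt (fun t : ℝ => fderiv ℝ F (x, t) (1, 0))
      (fderiv ℝ (fderiv ℝ F) (x, y) (0, 1) (1, 0)) y := by
    intro x y
    have h := ((hF'.differentiable one_ne_zero) (x, y)).hasFDerivAt.comp_hasDerivAt y
      ((hasDerivAt_const y x).prodMk (hasDerivAt_id y))
    exact h.clm_apply (hasDerivAt_const y ((1 : ℝ), (0 : ℝ))) |>.congr_deriv (by simp)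
  have hdF : ∀ x, HasDerivAt (fun t : ℝ => F (t, 0)) (fderiv ℝ F (x, 0) (1, 0)) x := fun x =>
    ((hF.differentiable two_ne_zero) (x, 0)).hasFDerivAt.comp_hasDerivAt x
      ((hasDerivAt_id x).prodMk (hasDerivAt_const x (0 : ℝ)))
  have hCδ : δ ≤ C * δ := le_mul_of_one_le_left hδ.le hC
  have hX : ∀ s ∈ Set.Icc (qx + δ / 2 - C * δ / 2) (qx + δ / 2 + C * δ / 2),
      ∀ t ∈ Set.Icc (qx + δ / 2 - C * δ / 2) (qx + δ / 2 + C * δ / 2), ∀ y,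
      |fderiv ℝ F (s, y) (1, 0) - fderiv ℝ F (t, y) (1, 0)| ≤
        ∫ r in (qx + δ / 2 - C * δ / 2)..(qx + δ / 2 + C * δ / 2), g (r, y) :=
    fun s hs t ht y =>
      abs_sub_le_integral_of_abs_deriv_le (by fun_prop) (g := fun r => g (r, y)) (by fun_prop)
        (fun x => hdx x y) (fun x => hbound _ _ (by simp [Prod.norm_def])) hs ht
  have hY : ∀ s ∈ Set.Icc (qy + δ / 2 - C * δ / 2) (qy + δ / 2 + C * δ / 2),
      ∀ t ∈ Set.Icc (qy + δ / 2 - C * δ / 2) (qy + δ / 2 + C * δ / 2), ∀ x,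
      |fderiv ℝ F (x, s) (1, 0) - fderiv ℝ F (x, t) (1, 0)| ≤
        ∫ r in (qy + δ / 2 - C * δ / 2)..(qy + δ / 2 + C * δ / 2), g (x, r) :=
    fun s hs t ht x =>
      abs_sub_le_integral_of_abs_deriv_le (by fun_prop) (g := fun r => g (x, r)) (by fun_prop)
        (fun y => hdy x y) (fun y => hbound _ _ (by simp [Prod.norm_def])) hs ht
  obtain ⟨h₁x, h₁y⟩ := h₁
  obtain ⟨h₂x, -⟩ := h₂
  have key := abs_average_square_sub_average_segment_le hu hg hg0 hδ (qx := qx) (qy := qy)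
    hX hY (by linarith) (by linarith) (by linarith) (by linarith) h₁x.1.le hx h₂x.2.le
    (Set.Ioo_subset_Icc_self h₁y)
  rw [← setIntegral_closedSq_eq_intervalIntegral hu _ _ hδ.le,
    intervalIntegral.integral_eq_sub_of_hasDerivAt (fun x _ => hdF x)
      (Continuous.intervalIntegrable (by fun_prop) _ _),
    ← setIntegral_Ioo_prod_Ioo_eq_intervalIntegral hg (by linarith) (by linarith)] at key
  refine key.trans ?_
  change (∫ z in openSq qx qy δ C, g z) / δ + (∫ z in openSq qx qy δ C, g z) / (x₂ - x₁) ≤ _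
  have hK : 0 ≤ ∫ z in openSq qx qy δ C, g z := integral_nonneg hg0
  rw [abs_sub_comm, abs_of_pos (sub_pos.2 hx)] at h₁₂
  calc _ ≤ (∫ z in openSq qx qy δ C, g z) / δ + (∫ z in openSq qx qy δ C, g z) / (c * δ) := by
        gcongr
    _ = _ := by field_simp

/-- Let `1 < p < 2`, `p̃ = (1+p)/2`, `C > 1.1`, `c > 0`. There is `C_p`
depending only on `c`, `C`, `p` such that for every C² function `F`, every closed square
`Q` of side `δ > 0`, and all points `z₁ = (x₁,0), z₂ = (x₂,0) ∈ CQ` with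
`|x₁ - x₂| ≥ c·δ`,
`δ^{2-p} |Av_Q ∂_x F - (F(z₂)-F(z₁))/(x₂-x₁)|^p ≤
  C_p δ² ((1/|CQ|) ∫_{CQ} |∇²F|^{p̃})^{p/p̃}`. -/
theorem difference_quotient_x_estimate
    (p C c : ℝ) (hp1 : 1 < p) (hp2 : p < 2) (hC : 1.1 < C) (hc : 0 < c) :
    ∃ Cp : ℝ, 0 < Cp ∧
      ∀ (F : ℝ × ℝ → ℝ) (qx qy δ x₁ x₂ : ℝ), ContDiff ℝ 2 F → 0 < δ →
        ((x₁, (0 : ℝ)) ∈ openSq qx qy δ C) → ((x₂, (0 : ℝ)) ∈ openSq qx qy δ C) →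
        c * δ ≤ |x₁ - x₂| →
        δ ^ (2 - p) *
            |avDx F qx qy δ - (F (x₂, 0) - F (x₁, 0)) / (x₂ - x₁)| ^ p ≤
          Cp * δ ^ (2 : ℝ) *
            (((C * δ) ^ 2)⁻¹ *
                ∫ z in openSq qx qy δ C,
                  ‖iteratedFDeriv ℝ 2 F z‖ ^ ((1 + p) / 2)) ^ (p / ((1 + p) / 2)) := by
  have hC0 : 0 < C := by linarith
  refine ⟨((1 + 1 / c) * C ^ 2) ^ p, by positivity, ?_⟩
  intro F qx qy δ x₁ x₂ hF hδ h₁ h₂ h₁₂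
  have hq : 1 ≤ (1 + p) / 2 := by linarith
  have hL1 := abs_avDx_sub_slope_le hF (by linarith) hc hδ h₁ h₂ h₁₂
  have hJensen := rpow_average_openSq_le (hF.continuous_iteratedFDeriv le_rfl).norm
    (fun z => norm_nonneg _) qx qy (mul_pos hC0 hδ) hq
  set m := ((C * δ) ^ 2)⁻¹ * ∫ z in openSq qx qy δ C, ‖iteratedFDeriv ℝ 2 F z‖ with hm
  have hm0 : 0 ≤ m := mul_nonneg (by positivity) (integral_nonneg fun z => norm_nonneg _)
  have hL1' : |avDx F qx qy δ - (F (x₂, 0) - F (x₁, 0)) / (x₂ - x₁)| ≤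
      (1 + 1 / c) * C ^ 2 * δ * m := by
    refine hL1.trans_eq ?_
    rw [hm]
    field_simp
  have hmp : m ^ p = (m ^ ((1 + p) / 2)) ^ (p / ((1 + p) / 2)) := by
    rw [← Real.rpow_mul hm0, mul_div_cancel₀ _ (by positivity)]
  have hδp : δ ^ (2 - p) * δ ^ p = δ ^ (2 : ℝ) := by
    rw [← Real.rpow_add hδ, sub_add_cancel]
  calc _ ≤ δ ^ (2 - p) * ((1 + 1 / c) * C ^ 2 * δ * m) ^ p := by gcongr
    _ = ((1 + 1 / c) * C ^ 2) ^ p * δ ^ (2 : ℝ) * m ^ p := by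
        rw [Real.mul_rpow (by positivity) hm0, Real.mul_rpow (by positivity) hδ.le, ← hδp]
        ring
    _ ≤ _ := by
        rw [hmp]
        gcongr
end

section
/- If Q and Q' are Calderón–Zygmund squares (Q, Q' ∈ CZ) with Q ∩ Q' ≠ ∅, then their side lengths satisfy (1/2)·δ_Q ≤ δ_{Q'} ≤ 2·δ_Q. -/
/-- An axis-parallel square, recorded by its lower-left corner `(x, y)` and side length `s`. -/
structure Sq where
  x : ℝ
  y : ℝ
  s : ℝ

namespace Sq

/-- The (closed) square as a subset of ℝ². -/
def set (Q : Sq) : Set (ℝ × ℝ) :=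
  Set.Icc Q.x (Q.x + Q.s) ×ˢ Set.Icc Q.y (Q.y + Q.s)

/-- `Q.dilate C` is the *open* axis-parallel square `CQ` with the same center as `Q` and
side length `C·δ_Q`. -/
def dilate (Q : Sq) (C : ℝ) : Set (ℝ × ℝ) :=
  Set.Ioo (Q.x + Q.s / 2 - C * Q.s / 2) (Q.x + Q.s / 2 + C * Q.s / 2) ×ˢ
    Set.Ioo (Q.y + Q.s / 2 - C * Q.s / 2) (Q.y + Q.s / 2 + C * Q.s / 2)

/-- Dyadic squares: `Q⁰ = [-1,1]²` and all closed squares obtained from `Q⁰` by successive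
bisection, i.e. `[i·2^{-k}, (i+1)·2^{-k}] × [j·2^{-k}, (j+1)·2^{-k}]` with
`i, j ∈ {-2^k, …, 2^k - 1}`. -/
def IsDyadic (Q : Sq) : Prop :=
  (Q.x = -1 ∧ Q.y = -1 ∧ Q.s = 2) ∨
    ∃ (k : ℕ) (i j : ℤ), -(2 ^ k : ℤ) ≤ i ∧ i < 2 ^ k ∧ -(2 ^ k : ℤ) ≤ j ∧ j < 2 ^ k ∧
      Q.x = (i : ℝ) * (2 : ℝ) ^ (-(k : ℤ)) ∧ Q.y = (j : ℝ) * (2 : ℝ) ^ (-(k : ℤ)) ∧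
      Q.s = (2 : ℝ) ^ (-(k : ℤ))

end Sq

/-- A closed interval, recorded by its left endpoint `a` and length `len`. -/
structure Iv where
  a : ℝ
  len : ℝ

namespace Iv

/-- The (closed) interval as a subset of ℝ. -/
def set (I : Iv) : Set ℝ := Set.Icc I.a (I.a + I.len)

/-- `I.dil C` is the *open* interval `CI` with the same center as `I` and length `C·|I|`. -/
def dil (I : Iv) (C : ℝ) : Set ℝ :=
  Set.Ioo (I.a + I.len / 2 - C * I.len / 2) (I.a + I.len / 2 + C * I.len / 2)

/-- Dyadic intervals: `I⁰ = [-1,1]` and all closed intervals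
`[i·2^{-k}, (i+1)·2^{-k}]` with `i ∈ {-2^k, …, 2^k - 1}`, obtained from `I⁰` by
successive bisection. -/
def IsDyadic (I : Iv) : Prop :=
  (I.a = -1 ∧ I.len = 2) ∨
    ∃ (k : ℕ) (i : ℤ), -(2 ^ k : ℤ) ≤ i ∧ i < 2 ^ k ∧
      I.a = (i : ℝ) * (2 : ℝ) ^ (-(k : ℤ)) ∧ I.len = (2 : ℝ) ^ (-(k : ℤ))

end Iv

/-- `E = Ē × {0} ⊂ ℝ²`. -/
def Eset (Ebar : Finset ℝ) : Set (ℝ × ℝ) := {z | z.1 ∈ Ebar ∧ z.2 = 0}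

/-- The hypotheses on the finite set `Ē ⊂ ℝ`: `#Ē ≥ 2` (so `N = #E ≥ 2`),
`max Ē = 2^{-11}` and `min Ē = -2^{-11}`. -/
def EbarHyp (Ebar : Finset ℝ) : Prop :=
  2 ≤ Ebar.card ∧ (2 : ℝ) ^ (-(11 : ℤ)) ∈ Ebar ∧ -(2 : ℝ) ^ (-(11 : ℤ)) ∈ Ebar ∧
    ∀ x ∈ Ebar, -(2 : ℝ) ^ (-(11 : ℤ)) ≤ x ∧ x ≤ (2 : ℝ) ^ (-(11 : ℤ))

/-- The Calderón–Zygmund collection `CZ`: the maximal dyadic squares `Q` such that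
`#(E ∩ 3Q) ≤ 1` (where `3Q` is the open concentric dilation). -/
def CZ (Ebar : Finset ℝ) (Q : Sq) : Prop :=
  Q.IsDyadic ∧ (Eset Ebar ∩ Q.dilate 3).Subsingleton ∧
    ∀ Q' : Sq, Q'.IsDyadic → (Eset Ebar ∩ Q'.dilate 3).Subsingleton →
      Q.set ⊆ Q'.set → Q.set = Q'.set

/-- The shadow `π(Q)` of a square `Q`, where `π(x,y) = x`. -/
def shadow (Q : Sq) : Iv := ⟨Q.x, Q.s⟩

/-- `Ē⁺ = Ē ∪ {-1}`. -/
noncomputable def EbarPlus (Ebar : Finset ℝ) : Finset ℝ := insert (-1) Ebar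

/-- `I` is a shadow of some CZ square. -/
def IsShadow (Ebar : Finset ℝ) (I : Iv) : Prop :=
  ∃ Q : Sq, CZ Ebar Q ∧ shadow Q = I

/-- The group `Gp(x*)`: the set of shadows `I` of CZ squares such that
(a) `x* ≤ inf 41I` (note `inf 41I = I.a - 20·|I|`), and
(b) `Ē⁺ ∩ (x*, inf 9I] = ∅` (note `inf 9I = I.a - 4·|I|`). -/
def Gp (Ebar : Finset ℝ) (xstar : ℝ) (I : Iv) : Prop :=
  IsShadow Ebar I ∧ xstar ≤ I.a - 20 * I.len ∧
    ∀ x ∈ EbarPlus Ebar, ¬(xstar < x ∧ x ≤ I.a - 4 * I.len)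

/-- A shadow `I` is *easy* (for the parameter `K`) if `diam(Ē⁺ ∩ KI) ≥ K⁻¹·|I|`. -/
def EasyShadow (Ebar : Finset ℝ) (K : ℝ) (I : Iv) : Prop :=
  ∃ u ∈ EbarPlus Ebar, ∃ v ∈ EbarPlus Ebar,
    u ∈ I.dil K ∧ v ∈ I.dil K ∧ K⁻¹ * I.len ≤ |u - v|

/-- The square `Q_inner = [-2^{-10}, 2^{-10}]²`. -/
def Qinner : Set (ℝ × ℝ) :=
  Set.Icc (-(2 : ℝ) ^ (-(10 : ℤ))) ((2 : ℝ) ^ (-(10 : ℤ))) ×ˢ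
    Set.Icc (-(2 : ℝ) ^ (-(10 : ℤ))) ((2 : ℝ) ^ (-(10 : ℤ)))

/-- A CZ square is *relevant* if `1.1Q ∩ Q_inner ≠ ∅`. -/
def Relevant (Ebar : Finset ℝ) (Q : Sq) : Prop :=
  CZ Ebar Q ∧ (Q.dilate 1.1 ∩ Qinner).Nonempty

namespace Sq

theorem IsDyadic.exists_side_eq_zpow {Q : Sq} (hQ : Q.IsDyadic) :
    ∃ n : ℤ, n ≤ 1 ∧ Q.s = (2 : ℝ) ^ n := by
  rcases hQ with ⟨-, -, h⟩ | ⟨k, i, j, -, -, -, -, -, -, h⟩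
  · exact ⟨1, le_rfl, by simpa using h⟩
  · exact ⟨-k, by omega, h⟩

theorem IsDyadic.side_pos {Q : Sq} (hQ : Q.IsDyadic) : 0 < Q.s := by
  obtain ⟨n, -, h⟩ := hQ.exists_side_eq_zpow
  rw [h]
  positivity

theorem IsDyadic.side_le_two {Q : Sq} (hQ : Q.IsDyadic) : Q.s ≤ 2 := by
  obtain ⟨n, hn, h⟩ := hQ.exists_side_eq_zpow
  rw [h]
  simpa using zpow_le_zpow_right₀ (one_le_two (α := ℝ)) hn

/-- Side lengths of dyadic squares that differ by more than a factor `2` differ by at least a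
factor `4`. -/
theorem IsDyadic.four_mul_side_le {Q Q' : Sq} (hQ : Q.IsDyadic) (hQ' : Q'.IsDyadic)
    (h : 2 * Q.s < Q'.s) : 4 * Q.s ≤ Q'.s := by
  obtain ⟨n, -, hn⟩ := hQ.exists_side_eq_zpow
  obtain ⟨m, -, hm⟩ := hQ'.exists_side_eq_zpow
  rw [hn, hm] at h ⊢
  have h2 : (2 : ℝ) * 2 ^ n = 2 ^ (n + 1) := by
    rw [zpow_add_one₀ two_ne_zero, mul_comm]
  have h4 : (4 : ℝ) * 2 ^ n = 2 ^ (n + 1 + 1) := by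
    rw [zpow_add_one₀ two_ne_zero, ← h2]
    ring
  rw [h2, zpow_lt_zpow_iff_right₀ one_lt_two] at h
  rw [h4]
  exact zpow_le_zpow_right₀ one_le_two (by omega)

theorem set_subset_set {Q P : Sq} (hx : P.x ≤ Q.x) (hx' : Q.x + Q.s ≤ P.x + P.s)
    (hy : P.y ≤ Q.y) (hy' : Q.y + Q.s ≤ P.y + P.s) : Q.set ⊆ P.set :=
  Set.prod_mono (Set.Icc_subset_Icc hx hx') (Set.Icc_subset_Icc hy hy')

/-- Every dyadic square other than `[-1,1]²` is contained in a dyadic square of twice its side. -/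
theorem IsDyadic.exists_parent {Q : Sq} (hQ : Q.IsDyadic) (hs : Q.s < 2) :
    ∃ P : Sq, P.IsDyadic ∧ P.s = 2 * Q.s ∧ Q.set ⊆ P.set := by
  rcases hQ with ⟨-, -, h⟩ | ⟨k, i, j, hi, hi', hj, hj', hx, hy, h⟩
  · exact absurd h hs.ne
  rcases k with _ | k
  · have bounds {a : ℤ} (ha : -1 ≤ a) (ha' : a < 1) : (-1 : ℝ) ≤ a ∧ (a : ℝ) + 1 ≤ 1 := by
      constructor
      · exact_mod_cast ha
      · exact_mod_cast ha'
    simp only [pow_zero, Nat.cast_zero, neg_zero, zpow_zero, mul_one] at hi hi' hj hj' hx hy h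
    have bi := bounds hi hi'
    have bj := bounds hj hj'
    refine ⟨⟨-1, -1, 2⟩, Or.inl ⟨rfl, rfl, rfl⟩, by simp [h], ?_⟩
    apply set_subset_set <;> simp only [hx, hy, h] <;> linarith
  · have hr : (2 : ℝ) ^ (-(k : ℤ)) = 2 * 2 ^ (-((k + 1 : ℕ) : ℤ)) := by
      rw [mul_comm, ← zpow_add_one₀ two_ne_zero]
      congr 1
      push_cast
      ring
    have hpos : (0 : ℝ) < 2 ^ (-((k + 1 : ℕ) : ℤ)) := by positivity
    have bounds (a : ℤ) : 2 * ((a / 2 : ℤ) : ℝ) ≤ a ∧ (a : ℝ) + 1 ≤ 2 * ((a / 2 : ℤ) : ℝ) + 2 := by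
      constructor
      · exact_mod_cast (by omega : 2 * (a / 2) ≤ a)
      · exact_mod_cast (by omega : a + 1 ≤ 2 * (a / 2) + 2)
    rw [pow_succ] at hi hi' hj hj'
    refine ⟨⟨(i / 2 : ℤ) * 2 ^ (-(k : ℤ)), (j / 2 : ℤ) * 2 ^ (-(k : ℤ)), 2 ^ (-(k : ℤ))⟩,
      Or.inr ⟨k, i / 2, j / 2, by omega, by omega, by omega, by omega, rfl, rfl, rfl⟩,
      by rw [h, hr], ?_⟩
    have bi := bounds i
    have bj := bounds j
    apply set_subset_set <;> simp only [hx, hy, h, hr] <;> nlinarith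

/-- If two squares meet and one is at least twice as large as the other, the triples are nested. -/
theorem dilate_three_subset {P Q : Sq} (hmeet : (P.set ∩ Q.set).Nonempty)
    (h : 2 * P.s ≤ Q.s) : P.dilate 3 ⊆ Q.dilate 3 := by
  obtain ⟨⟨a, b⟩, ⟨⟨hPa, hPa'⟩, hPb, hPb'⟩, ⟨hQa, hQa'⟩, hQb, hQb'⟩ := hmeet
  dsimp only at hPa hPa' hPb hPb' hQa hQa' hQb hQb'
  apply Set.prod_mono <;> apply Set.Ioo_subset_Ioo <;> linarith

theorem side_eq_of_set_eq {P Q : Sq} (hP : 0 < P.s) (h : P.set = Q.set) :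
    P.s = Q.s := by
  have hl : (P.x, P.y) ∈ Q.set := by
    rw [← h]
    exact ⟨⟨le_rfl, by simpa using hP.le⟩, le_rfl, by simpa using hP.le⟩
  have hQ : 0 ≤ Q.s := by
    have := hl.1.1.trans hl.1.2
    linarith
  have hu : (P.x + P.s, P.y + P.s) ∈ Q.set := by
    rw [← h]
    exact ⟨⟨by simpa using hP.le, le_rfl⟩, by simpa using hP.le, le_rfl⟩
  have hl' : (Q.x, Q.y) ∈ P.set := by
    rw [h]
    exact ⟨⟨le_rfl, by simpa using hQ⟩, le_rfl, by simpa using hQ⟩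
  have hu' : (Q.x + Q.s, Q.y + Q.s) ∈ P.set := by
    rw [h]
    exact ⟨⟨by simpa using hQ, le_rfl⟩, by simpa using hQ, le_rfl⟩
  have h₁ := hl.1.1
  have h₂ := hu.1.2
  have h₃ := hl'.1.1
  have h₄ := hu'.1.2
  dsimp only at h₁ h₂ h₃ h₄
  linarith

end Sq

theorem CZ.side_le_two_mul {Ebar : Finset ℝ} {Q Q' : Sq} (hQ : CZ Ebar Q) (hQ' : CZ Ebar Q')
    (hmeet : (Q.set ∩ Q'.set).Nonempty) : Q'.s ≤ 2 * Q.s := by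
  by_contra! hlt
  obtain ⟨hQd, -, hmax⟩ := hQ
  obtain ⟨hQd', hsub, -⟩ := hQ'
  have hpos := hQd.side_pos
  obtain ⟨P, hPd, hPs, hQP⟩ := hQd.exists_parent (by linarith [hQd'.side_le_two])
  have hle := hQd.four_mul_side_le hQd' hlt
  have hdil : P.dilate 3 ⊆ Q'.dilate 3 :=
    Sq.dilate_three_subset (hmeet.mono (Set.inter_subset_inter_left _ hQP)) (by linarith)
  have heq := hmax P hPd (hsub.anti (Set.inter_subset_inter_right _ hdil)) hQP
  linarith [Sq.side_eq_of_set_eq hpos heq]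

/-- good geometry: if `Q, Q' ∈ CZ` and `Q ∩ Q' ≠ ∅`, then
`(1/2)·δ_Q ≤ δ_{Q'} ≤ 2·δ_Q`. -/
theorem CZ_good_geometry (Ebar : Finset ℝ) (hE : EbarHyp Ebar)
    (Q Q' : Sq) (hQ : CZ Ebar Q) (hQ' : CZ Ebar Q')
    (hmeet : (Q.set ∩ Q'.set).Nonempty) :
    Q.s / 2 ≤ Q'.s ∧ Q'.s ≤ 2 * Q.s := by
  have h := hQ'.side_le_two_mul hQ (Set.inter_comm _ _ ▸ hmeet)
  exact ⟨by linarith, hQ.side_le_two_mul hQ' hmeet⟩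
end

section
/- Every Calderón–Zygmund square Q ∈ CZ has one of the following forms for some dyadic interval I: a 'contact square' I×[0,|I|] or I×[−|I|,0], or a 'contactless square' I×[|I|,2|I|] or I×[−2|I|,−|I|]. Moreover, if Q is a contactless square, then E ∩ 3Q = ∅. -/
/-- The interval of length `s` with index `i` lies in the one of length `2s` with index `i / 2`. -/
theorem Icc_dyadic_subset_parent (i : ℤ) {s : ℝ} (hs : 0 < s) :
    Set.Icc ((i : ℝ) * s) (i * s + s) ⊆
      Set.Icc (((i / 2 : ℤ) : ℝ) * (2 * s)) ((i / 2 : ℤ) * (2 * s) + 2 * s) := by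
  have h₁ : ((2 * (i / 2) : ℤ) : ℝ) ≤ i := by exact_mod_cast (by omega)
  have h₂ : (i : ℝ) ≤ ((2 * (i / 2) + 1 : ℤ) : ℝ) := by exact_mod_cast (by omega)
  push_cast at h₁ h₂
  exact Set.Icc_subset_Icc (by nlinarith) (by nlinarith)

/-- A square contained in another one has at most its side length. -/
theorem Sq.s_le_of_set_subset {P Q : Sq} (hP : 0 ≤ P.s) (h : P.set ⊆ Q.set) : P.s ≤ Q.s := by
  have h₁ : (P.x, P.y) ∈ Q.set := h ⟨by simpa using hP, by simpa using hP⟩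
  have h₂ : (P.x + P.s, P.y + P.s) ∈ Q.set := h ⟨by simpa using hP, by simpa using hP⟩
  have h₃ := h₁.1.1
  have h₄ := h₂.1.2
  dsimp only at h₃ h₄
  linarith

/-- The triple of a square in row `j` meets the horizontal axis only if `j` is `-1` or `0`. -/
theorem row_eq_of_dilate_three {Q : Sq} {j : ℤ} (hs : 0 < Q.s) (hy : Q.y = j * Q.s)
    {z : ℝ × ℝ} (hz : z ∈ Q.dilate 3) (hz0 : z.2 = 0) : j = -1 ∨ j = 0 := by
  obtain ⟨h₁, h₂⟩ := hz.2
  rw [hz0, hy] at h₁ h₂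
  have h₃ : (j : ℝ) < 1 := by nlinarith
  have h₄ : (-2 : ℝ) < j := by nlinarith
  have h₅ : j < 1 := by exact_mod_cast h₃
  have h₆ : -2 < j := by exact_mod_cast h₄
  omega

/-- A CZ square of generation `k + 1` and row `j` has its dyadic parent in row `-1` or `0`. -/
theorem CZ.parent_row {Ebar : Finset ℝ} {Q : Sq} (hQ : CZ Ebar Q) {k : ℕ} {i j : ℤ}
    (hi : -(2 ^ (k + 1) : ℤ) ≤ i) (hi' : i < 2 ^ (k + 1))
    (hj : -(2 ^ (k + 1) : ℤ) ≤ j) (hj' : j < 2 ^ (k + 1))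
    (hx : Q.x = i * Q.s) (hy : Q.y = j * Q.s) (hs : Q.s = (2 : ℝ) ^ (-((k + 1 : ℕ) : ℤ))) :
    j / 2 = -1 ∨ j / 2 = 0 := by
  have hs0 : 0 < Q.s := hs ▸ by positivity
  have hs2 : 2 * Q.s = (2 : ℝ) ^ (-(k : ℤ)) := by
    rw [hs, ← zpow_one_add₀ (two_ne_zero)]
    congr 1
    push_cast
    ring
  let P : Sq := ⟨(i / 2 : ℤ) * (2 * Q.s), (j / 2 : ℤ) * (2 * Q.s), 2 * Q.s⟩
  have hP : P.IsDyadic := by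
    rw [pow_succ] at hi hi' hj hj'
    exact Or.inr ⟨k, i / 2, j / 2, by omega, by omega, by omega, by omega,
      by rw [← hs2], by rw [← hs2], hs2⟩
  have hQP : Q.set ⊆ P.set := by
    unfold Sq.set
    rw [hx, hy]
    exact Set.prod_mono (Icc_dyadic_subset_parent i hs0) (Icc_dyadic_subset_parent j hs0)
  have hnot : ¬ (Eset Ebar ∩ P.dilate 3).Subsingleton := fun h ↦ by
    have hle : 2 * Q.s ≤ Q.s := Sq.s_le_of_set_subset (P := P)
      (mul_nonneg zero_le_two hs0.le) (hQ.2.2 P hP h hQP).symm.subset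
    linarith
  obtain ⟨z, hz, -⟩ := (Set.not_subsingleton_iff.1 hnot)
  exact row_eq_of_dilate_three (Q := P) (mul_pos two_pos hs0) rfl hz.2 hz.1.2

/-- The square `[-1,1]²` is not a CZ square. -/
theorem CZ.s_ne_two {Ebar : Finset ℝ} (hE : EbarHyp Ebar) {Q : Sq} (hQ : CZ Ebar Q)
    (hx : Q.x = -1) (hy : Q.y = -1) : Q.s ≠ 2 := by
  intro hs
  have hmem : ∀ t ∈ Ebar, (t, (0 : ℝ)) ∈ Eset Ebar ∩ Q.dilate 3 := fun t ht ↦ by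
    obtain ⟨h₁, h₂⟩ := hE.2.2.2 t ht
    norm_num at h₁ h₂
    refine ⟨⟨ht, rfl⟩, ?_, ?_⟩ <;> simp only [hx, hy, hs] <;> constructor <;> linarith
  have h := congrArg Prod.fst (hQ.2.1 (hmem _ hE.2.1) (hmem _ hE.2.2.1))
  norm_num at h

/-- every CZ square `Q` has, for some dyadic interval `I`, one of the forms
`I × [0,|I|]` or `I × [-|I|,0]` (contact squares), or `I × [|I|,2|I|]` or
`I × [-2|I|,-|I|]` (contactless squares); and in the contactless case `E ∩ 3Q = ∅`. -/
theorem CZ_contact_or_contactless (Ebar : Finset ℝ) (hE : EbarHyp Ebar)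
    (Q : Sq) (hQ : CZ Ebar Q) :
    ∃ I : Iv, I.IsDyadic ∧ Q.x = I.a ∧ Q.s = I.len ∧
      (Q.y = 0 ∨ Q.y = -I.len ∨
        ((Q.y = I.len ∨ Q.y = -2 * I.len) ∧ Eset Ebar ∩ Q.dilate 3 = ∅)) := by
  rcases hQ.1 with ⟨hx, hy, hs⟩ | ⟨k, i, j, hi, hi', hj, hj', hx, hy, hs⟩
  · exact absurd hs (hQ.s_ne_two hE hx hy)
  refine ⟨⟨Q.x, Q.s⟩, Or.inr ⟨k, i, hi, hi', hx, hs⟩, rfl, rfl, ?_⟩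
  have hs0 : 0 < Q.s := hs ▸ by positivity
  rw [← hs] at hx hy
  have hrow : j = 0 ∨ j = -1 ∨ j = 1 ∨ j = -2 := by
    cases k with
    | zero =>
      rw [pow_zero] at hj hj'
      omega
    | succ k =>
      have := hQ.parent_row hi hi' hj hj' hx hy hs
      omega
  have hempty (h : j = 1 ∨ j = -2) : Eset Ebar ∩ Q.dilate 3 = ∅ :=
    Set.eq_empty_of_forall_notMem fun z hz ↦ by
      have := row_eq_of_dilate_three hs0 hy hz.2 hz.1.2
      omega
  rcases hrow with rfl | rfl | rfl | rfl
  · exact Or.inl (by simpa using hy)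
  · exact Or.inr (Or.inl (by simpa using hy))
  · exact Or.inr (Or.inr ⟨Or.inl (by simpa using hy), hempty (Or.inl rfl)⟩)
  · exact Or.inr (Or.inr ⟨Or.inr (by simpa using hy), hempty (Or.inr rfl)⟩)
end

section
/- Let I = π(Q) be the shadow of some Calderón–Zygmund square Q ∈ CZ. If |I| ≤ 1/4, then the dyadic parent I⁺ of I is the shadow of some Calderón–Zygmund square, i.e. I⁺ = π(Q') for some Q' ∈ CZ. -/
theorem Sq.set_subset_iff {Q R : Sq} (hQ : 0 ≤ Q.s) :
    Q.set ⊆ R.set ↔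
      (R.x ≤ Q.x ∧ Q.x + Q.s ≤ R.x + R.s) ∧ R.y ≤ Q.y ∧ Q.y + Q.s ≤ R.y + R.s := by
  unfold Sq.set
  constructor
  · intro h
    have h₁ : (Q.x, Q.y) ∈ Set.Icc R.x (R.x + R.s) ×ˢ Set.Icc R.y (R.y + R.s) :=
      h ⟨⟨le_rfl, by simpa⟩, ⟨le_rfl, by simpa⟩⟩
    have h₂ : (Q.x + Q.s, Q.y + Q.s) ∈ Set.Icc R.x (R.x + R.s) ×ˢ Set.Icc R.y (R.y + R.s) :=
      h ⟨⟨by simpa, le_rfl⟩, ⟨by simpa, le_rfl⟩⟩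
    exact ⟨⟨h₁.1.1, h₂.1.2⟩, h₁.2.1, h₂.2.2⟩
  · rintro ⟨⟨h₁, h₂⟩, h₃, h₄⟩
    exact Set.prod_mono (Set.Icc_subset_Icc h₁ h₂) (Set.Icc_subset_Icc h₃ h₄)

theorem Sq.IsDyadic.side_pos_s12 {Q : Sq} (hQ : Q.IsDyadic) : 0 < Q.s := by
  rcases hQ with ⟨-, -, h⟩ | ⟨k, i, j, -, -, -, -, -, -, h⟩ <;> rw [h] <;> positivity

/-- A dyadic square of side at least `2^{-m}` has side `2^{-m}` or at least twice that. -/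
theorem Sq.IsDyadic.side_eq_or_two_mul_le {Q : Sq} (hQ : Q.IsDyadic) {m : ℕ}
    (h : (2 : ℝ) ^ (-(m : ℤ)) ≤ Q.s) :
    Q.s = (2 : ℝ) ^ (-(m : ℤ)) ∨ 2 * (2 : ℝ) ^ (-(m : ℤ)) ≤ Q.s := by
  rcases hQ with ⟨-, -, hs⟩ | ⟨k, i, j, -, -, -, -, -, -, hs⟩
  · right
    have : (2 : ℝ) ^ (-(m : ℤ)) ≤ 1 := zpow_le_one_of_nonpos₀ (by norm_num) (by omega)
    linarith
  · rw [hs] at h ⊢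
    have hkm : -(m : ℤ) ≤ -(k : ℤ) := (zpow_le_zpow_iff_right₀ (by norm_num)).1 h
    rcases hkm.eq_or_lt with he | hlt
    · exact Or.inl (by rw [he])
    · right
      calc 2 * (2 : ℝ) ^ (-(m : ℤ)) = (2 : ℝ) ^ (-(m : ℤ) + 1) := by
            rw [zpow_add_one₀ (by norm_num), mul_comm]
        _ ≤ _ := zpow_le_zpow_right₀ (by norm_num) (by omega)

/-- if `I = π(Q)` is the shadow of a CZ square `Q` and `|I| ≤ 1/4`, then the
dyadic parent `I⁺` of `I` (the dyadic interval of length `2|I|` containing `I`) is the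
shadow of some CZ square `Q'`. -/
theorem parent_shadow (Ebar : Finset ℝ) (hE : EbarHyp Ebar)
    (Q : Sq) (hQ : CZ Ebar Q) (hs : Q.s ≤ 1 / 4) :
    ∃ Q' : Sq, CZ Ebar Q' ∧ Q'.s = 2 * Q.s ∧ (shadow Q).set ⊆ (shadow Q').set := by
  obtain ⟨hdy, -, hmax⟩ := hQ
  rcases hdy with ⟨-, -, h⟩ | ⟨k, i, j, hi, hi', hj, hj', hx, hy, hk⟩
  · linarith
  obtain ⟨m, rfl⟩ : ∃ m, k = m + 1 := by
    refine ⟨k - 1, ?_⟩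
    rcases k with _ | k
    · norm_num [hk] at hs
    · rfl
  have hm : m ≠ 0 := by
    rintro rfl
    norm_num [hk] at hs
  have hhalf : (2 : ℝ) ^ (-((m + 1 : ℕ) : ℤ)) = 2 ^ (-(m : ℤ)) / 2 := by
    rw [Nat.cast_add, Nat.cast_one, neg_add, ← sub_eq_add_neg, zpow_sub_one₀ (by norm_num),
      div_eq_mul_inv]
  rw [hhalf] at hx hy hk
  have hd : (0 : ℝ) < 2 ^ (-(m : ℤ)) := by positivity
  have hm₂ : (1 : ℤ) < 2 ^ m := one_lt_pow₀ (by norm_num) hm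
  have hdiv : ∀ n : ℤ, ((n / 2 : ℤ) : ℝ) * 2 ≤ n ∧ (n : ℝ) ≤ ((n / 2 : ℤ) : ℝ) * 2 + 1 := by
    intro n
    constructor
    · have : n / 2 * 2 ≤ n := by omega
      exact_mod_cast this
    · have : n ≤ n / 2 * 2 + 1 := by omega
      exact_mod_cast this
  rw [pow_succ] at hi hi' hj hj'
  set d : ℝ := 2 ^ (-(m : ℤ)) with hd_def
  have hcover : ∀ n : ℤ, ((n / 2 : ℤ) : ℝ) * d ≤ n * (d / 2) ∧
      n * (d / 2) + d / 2 ≤ ((n / 2 : ℤ) : ℝ) * d + d := by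
    intro n
    obtain ⟨h₁, h₂⟩ := hdiv n
    constructor <;> nlinarith
  obtain ⟨hi₁, hi₂⟩ := hcover i
  obtain ⟨hj₁, hj₂⟩ := hcover j
  set a : ℝ := ((i / 2 : ℤ) : ℝ) * d with ha
  set b : ℝ := ((j / 2 : ℤ) : ℝ) * d with hb
  -- The dyadic parent of `Q` is strictly larger, so its triple contains two points of `E`.
  have hparent : ¬ (Eset Ebar ∩ (Sq.mk a b d).dilate 3).Subsingleton := by
    intro hsub
    have hQs : (0 : ℝ) ≤ Q.s := by rw [hk]; positivity
    have heq := hmax ⟨a, b, d⟩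
      (Or.inr ⟨m, i / 2, j / 2, by omega, by omega, by omega, by omega, rfl, rfl, rfl⟩) hsub
      ((Sq.set_subset_iff hQs).2 (by
        simp only [hx, hy, hk]
        exact ⟨⟨hi₁, hi₂⟩, hj₁, hj₂⟩))
    have := ((Sq.set_subset_iff (Q := ⟨a, b, d⟩) hd.le).1 heq.ge).1
    simp only [hk] at this
    linarith
  refine ⟨⟨a, d, d⟩, ⟨?_, ?_, ?_⟩, ?_, ?_⟩
  · exact Or.inr ⟨m, i / 2, 1, by omega, by omega, by omega, hm₂, rfl, by simp [hd_def], rfl⟩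
  · rintro z ⟨⟨-, hz⟩, -, hz', -⟩
    simp only at hz'
    linarith
  · intro R hR hRsub hle
    obtain ⟨⟨h₁, h₂⟩, h₃, h₄⟩ := (Sq.set_subset_iff (Q := ⟨a, d, d⟩) hd.le).1 hle
    simp only at h₁ h₂ h₃ h₄
    rcases hR.side_eq_or_two_mul_le (m := m) (by linarith) with hRs | hRs
    · rw [← hd_def] at hRs
      refine hle.antisymm ((Sq.set_subset_iff hR.side_pos_s12.le).2 ?_)
      simp only [hRs] at h₂ h₄ ⊢
      exact ⟨⟨by linarith, by linarith⟩, by linarith, by linarith⟩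
    · rw [← hd_def] at hRs
      refine absurd (hRsub.anti ?_) hparent
      rintro z ⟨hz, ⟨hz₁, hz₂⟩, -⟩
      simp only at hz₁ hz₂
      refine ⟨hz, ⟨by linarith, by linarith⟩, ?_, ?_⟩ <;> rw [hz.2] <;> linarith
  · simp only [hk]
    ring
  · simp only [shadow, Iv.set, hx, hk]
    exact Set.Icc_subset_Icc hi₁ hi₂
end
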